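/- arXiv:1112.5087 — 2 statements merged into one kernel-verified Lean document; each statement's English description precedes it below -/
import Mathlib

section
/- Let μ be a Borel probability measure on ℝ and n ≥ 1 an integer. Then there exists a unique function Z in the class 𝓕 such that z = nZ(z) − (n−1)F_μ(Z(z)) for all z ∈ ℂ⁺; moreover, the function F_μ ∘ Z again belongs to 𝓕, i.e. there exists a Borel probability measure ν on ℝ with F_ν(z) = F_μ(Z(z)) for all z ∈ ℂ⁺ (and ν = μ^{⊞n}). -/
open MeasureTheory Complex Filter Set
open scoped Topology

noncomputable section

namespace FreeCLT

def mom (μ : Measure ℝ) (k : ℕ) : ℝ := ∫ u, u ^ k ∂μ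

def cauchy (μ : Measure ℝ) (z : ℂ) : ℂ := ∫ u, (z - (u : ℂ))⁻¹ ∂μ

def recip (μ : Measure ℝ) (z : ℂ) : ℂ := (cauchy μ z)⁻¹

def MemF (F : ℂ → ℂ) : Prop :=
  ∃ ν : Measure ℝ, IsProbabilityMeasure ν ∧ ∀ z : ℂ, 0 < z.im → F z = recip ν z

def Subord (μ : Measure ℝ) (n : ℕ) (Z : ℂ → ℂ) : Prop :=
  MemF Z ∧ ∀ z : ℂ, 0 < z.im →
    z = (n : ℂ) * Z z - ((n : ℂ) - 1) * recip μ (Z z)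

def IsBoxPow (μ : Measure ℝ) (n : ℕ) (Z : ℂ → ℂ) (ν : Measure ℝ) : Prop :=
  Subord μ n Z ∧ IsProbabilityMeasure ν ∧
    ∀ z : ℂ, 0 < z.im → recip ν z = recip μ (Z z)

def rescale (n : ℕ) (ν : Measure ℝ) : Measure ℝ :=
  ν.map (fun x => x / Real.sqrt n)

def HasDensity (ν : Measure ℝ) (p : ℝ → ℝ) : Prop :=
  Continuous p ∧ (∀ x, 0 ≤ p x) ∧
    ν = MeasureTheory.volume.withDensity (fun x => ENNReal.ofReal (p x))

def aQ (μ : Measure ℝ) (n : ℕ) : ℝ := mom μ 3 / Real.sqrt n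
def bQ (μ : Measure ℝ) (n : ℕ) : ℝ := (mom μ 4 - (mom μ 3) ^ 2 - 1) / n
def dQ (μ : Measure ℝ) (n : ℕ) : ℝ := (mom μ 4 - (mom μ 3) ^ 2) / n
def eQ (μ : Measure ℝ) (n : ℕ) : ℝ := (1 - bQ μ n) / Real.sqrt (1 - dQ μ n)

def pw (x : ℝ) : ℝ := (1 / (2 * Real.pi)) * Real.sqrt (max (4 - x ^ 2) 0)

def truncSet (n : ℕ) : Set ℝ := {u : ℝ | |u| ≤ Real.sqrt ((n : ℝ) - 1) / Real.pi}

def Tfun (W : ℕ → ℂ → ℂ) (n : ℕ) (z : ℂ) : ℂ :=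
  W n ((Real.sqrt (n : ℝ) : ℂ) * z) / (Real.sqrt (n : ℝ) : ℂ)

lemma sub_ofReal_ne {z : ℂ} (hz : 0 < z.im) (u : ℝ) : z - (u : ℂ) ≠ 0 := by
  intro h
  have := congrArg Complex.im h
  simp at this
  linarith

lemma im_le_norm_sub {z : ℂ} (u : ℝ) : z.im ≤ ‖z - (u : ℂ)‖ := by
  have := Complex.im_le_norm (z - (u : ℂ))
  simpa using this

lemma norm_inv_sub_le {z : ℂ} (hz : 0 < z.im) (u : ℝ) : ‖(z - (u : ℂ))⁻¹‖ ≤ (z.im)⁻¹ := by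
  rw [norm_inv]
  exact inv_anti₀ hz (im_le_norm_sub u)

lemma continuous_inv_sub {z : ℂ} (hz : 0 < z.im) : Continuous fun u : ℝ => (z - (u : ℂ))⁻¹ :=
  Continuous.inv₀ (by fun_prop) (sub_ofReal_ne hz)

lemma integrable_of_bdd {E : Type*} [NormedAddCommGroup E] (μ : Measure ℝ) [IsFiniteMeasure μ]
    {f : ℝ → E} [SecondCountableTopologyEither ℝ E] (hf : Continuous f) (C : ℝ)
    (h : ∀ x, ‖f x‖ ≤ C) : Integrable f μ :=
  Integrable.of_bound hf.aestronglyMeasurable C (Eventually.of_forall h)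

lemma int_combo {E : Type*} [NormedAddCommGroup E] [NormedSpace ℝ E] {μ : Measure ℝ}
    {f g k : ℝ → E} (hf : Integrable f μ) (hg : Integrable g μ) (hk : Integrable k μ) :
    ∫ u, (f u - g u + k u) ∂μ = ∫ u, f u ∂μ - ∫ u, g u ∂μ + ∫ u, k u ∂μ := by
  have h1 := integral_sub hf hg
  have h2 := integral_add (hf.sub hg) hk
  simp only [Pi.sub_apply] at h2
  rw [h2, h1]

lemma integrable_inv_sub (μ : Measure ℝ) [IsFiniteMeasure μ] {z : ℂ} (hz : 0 < z.im) :
    Integrable (fun u : ℝ => (z - (u : ℂ))⁻¹) μ :=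
  integrable_of_bdd μ (continuous_inv_sub hz) _ (norm_inv_sub_le hz)

lemma inv_sub_im {z : ℂ} (u : ℝ) : ((z - (u : ℂ))⁻¹).im = - (z.im * ‖(z - (u : ℂ))⁻¹‖ ^ 2) := by
  rw [Complex.inv_im, norm_inv, inv_pow, ← Complex.normSq_eq_norm_sq]
  simp
  ring

lemma cauchy_im (μ : Measure ℝ) [IsFiniteMeasure μ] {z : ℂ} (hz : 0 < z.im) :
    (cauchy μ z).im = - (z.im * ∫ u : ℝ, ‖(z - (u : ℂ))⁻¹‖ ^ 2 ∂μ) := by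
  have h := integral_im (μ := μ) (f := fun u : ℝ => (z - (u : ℂ))⁻¹) (integrable_inv_sub μ hz)
  have h2 : (cauchy μ z).im = ∫ u : ℝ, ((z - (u : ℂ))⁻¹).im ∂μ := by
    rw [cauchy]; exact h.symm
  rw [h2]
  simp_rw [inv_sub_im]
  rw [integral_neg, integral_const_mul]

lemma integrable_sq (μ : Measure ℝ) [IsFiniteMeasure μ] {z : ℂ} (hz : 0 < z.im) :
    Integrable (fun u : ℝ => ‖(z - (u : ℂ))⁻¹‖ ^ 2) μ := by
  refine integrable_of_bdd μ ((continuous_inv_sub hz).norm.pow 2) ((z.im)⁻¹ ^ 2) fun x => ?_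
  rw [norm_pow, norm_norm]
  exact pow_le_pow_left₀ (norm_nonneg _) (norm_inv_sub_le hz x) 2

lemma integrable_mul2 (μ : Measure ℝ) [IsFiniteMeasure μ] {z w : ℂ} (hz : 0 < z.im)
    (hw : 0 < w.im) :
    Integrable (fun u : ℝ => (z - (u : ℂ))⁻¹ * (w - (u : ℂ))⁻¹) μ := by
  refine integrable_of_bdd μ ((continuous_inv_sub hz).mul (continuous_inv_sub hw))
    ((z.im)⁻¹ * (w.im)⁻¹) fun x => ?_
  rw [norm_mul]
  exact mul_le_mul (norm_inv_sub_le hz x) (norm_inv_sub_le hw x) (norm_nonneg _) (by positivity)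

lemma cauchy_im_neg (μ : Measure ℝ) [IsProbabilityMeasure μ] {z : ℂ} (hz : 0 < z.im) :
    (cauchy μ z).im < 0 := by
  rw [cauchy_im μ hz]
  have : 0 < ∫ u : ℝ, ‖(z - (u : ℂ))⁻¹‖ ^ 2 ∂μ := by
    rw [integral_pos_iff_support_of_nonneg (fun u => by positivity) (integrable_sq μ hz)]
    have : Function.support (fun u : ℝ => ‖(z - (u : ℂ))⁻¹‖ ^ 2) = univ := by
      ext u
      simp [sub_ofReal_ne hz u]
    rw [this]; simp
  have := mul_pos hz this
  linarith

lemma cauchy_ne (μ : Measure ℝ) [IsProbabilityMeasure μ] {z : ℂ} (hz : 0 < z.im) :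
    cauchy μ z ≠ 0 := by
  intro h
  have := cauchy_im_neg μ hz
  rw [h] at this; simp at this

lemma norm_cauchy_le (μ : Measure ℝ) [IsProbabilityMeasure μ] {z : ℂ} (hz : 0 < z.im) :
    ‖cauchy μ z‖ ≤ (z.im)⁻¹ := by
  have := norm_integral_le_of_norm_le_const (μ := μ) (Eventually.of_forall (norm_inv_sub_le hz))
  simpa [cauchy] using this

lemma cauchy_sub (μ : Measure ℝ) [IsFiniteMeasure μ] {z w : ℂ} (hz : 0 < z.im) (hw : 0 < w.im) :
    cauchy μ z - cauchy μ w = (w - z) * ∫ u : ℝ, (z - (u : ℂ))⁻¹ * (w - (u : ℂ))⁻¹ ∂μ := by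
  rw [cauchy, cauchy, ← integral_sub (integrable_inv_sub μ hz) (integrable_inv_sub μ hw),
    ← integral_const_mul]
  congr 1
  ext u
  have h1 := sub_ofReal_ne hz u
  have h2 := sub_ofReal_ne hw u
  field_simp
  ring

lemma cauchy_differentiableAt (μ : Measure ℝ) [IsFiniteMeasure μ] {z : ℂ} (hz : 0 < z.im) :
    DifferentiableAt ℂ (cauchy μ) z := by
  have hs : {w : ℂ | z.im / 2 < w.im} ∈ 𝓝 z :=
    (isOpen_lt continuous_const Complex.continuous_im).mem_nhds (by simp; linarith)
  refine (hasDerivAt_integral_of_dominated_loc_of_deriv_le (μ := μ) (𝕜 := ℂ)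
    (F := fun (w : ℂ) (u : ℝ) => (w - (u : ℂ))⁻¹)
    (F' := fun (w : ℂ) (u : ℝ) => -1 / (w - (u : ℂ)) ^ 2)
    (bound := fun _ => ((z.im / 2)⁻¹) ^ 2) hs ?_ (integrable_inv_sub μ hz) ?_ ?_
    (integrable_const _) ?_).2.differentiableAt
  · filter_upwards [hs] with w hw
    have hw' : 0 < w.im := by
      have hw1 : z.im / 2 < w.im := hw
      linarith
    exact (continuous_inv_sub hw').aestronglyMeasurable
  · refine Continuous.aestronglyMeasurable ?_
    refine Continuous.div continuous_const (by fun_prop) fun u => pow_ne_zero 2 (sub_ofReal_ne hz u)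
  · refine Eventually.of_forall fun u w hw => ?_
    have hw1 : z.im / 2 < w.im := hw
    rw [norm_div, norm_neg, norm_one, norm_pow, one_div, ← inv_pow]
    refine pow_le_pow_left₀ (by positivity) ?_ 2
    exact inv_anti₀ (by linarith) (hw1.le.trans (im_le_norm_sub u))
  · refine Eventually.of_forall fun u w hw => ?_
    have hw1 : z.im / 2 < w.im := hw
    have hw2 : 0 < w.im := by linarith
    have := ((hasDerivAt_id w).sub_const (u : ℂ)).inv (sub_ofReal_ne hw2 u)
    exact this

/-- `h = F - id`. -/
def hh (μ : Measure ℝ) (w : ℂ) : ℂ := recip μ w - w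

def phi (μ : Measure ℝ) (w : ℂ) (u : ℝ) : ℂ := (w - (u : ℂ))⁻¹ * recip μ w - 1

lemma hh_differentiableAt (μ : Measure ℝ) [IsProbabilityMeasure μ] {z : ℂ} (hz : 0 < z.im) :
    DifferentiableAt ℂ (hh μ) z := by
  unfold hh recip
  exact ((cauchy_differentiableAt μ hz).inv (cauchy_ne μ hz)).sub differentiableAt_id

lemma phi_cont (μ : Measure ℝ) {z : ℂ} (hz : 0 < z.im) : Continuous (phi μ z) :=
  ((continuous_inv_sub hz).mul continuous_const).sub continuous_const

lemma phi_bdd (μ : Measure ℝ) {z : ℂ} (hz : 0 < z.im) :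
    ∃ C, 0 ≤ C ∧ ∀ u, ‖phi μ z u‖ ≤ C := by
  refine ⟨(z.im)⁻¹ * ‖recip μ z‖ + 1, by positivity, fun u => ?_⟩
  refine (norm_sub_le _ _).trans ?_
  rw [norm_mul, norm_one]
  gcongr
  exact norm_inv_sub_le hz u

lemma hh_sub (μ : Measure ℝ) [IsProbabilityMeasure μ] {z w : ℂ} (hz : 0 < z.im) (hw : 0 < w.im) :
    hh μ z - hh μ w = (z - w) * ∫ u, phi μ z u * phi μ w u ∂μ := by
  have e : ∀ u : ℝ, phi μ z u * phi μ w u = ((z - (u : ℂ))⁻¹ * (w - (u : ℂ))⁻¹) *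
      (recip μ z * recip μ w) - (z - (u : ℂ))⁻¹ * recip μ z - (w - (u : ℂ))⁻¹ * recip μ w + 1 := by
    intro u; unfold phi; ring
  simp_rw [e]
  have i1 := (integrable_mul2 μ hz hw).mul_const (recip μ z * recip μ w)
  have i2 := (integrable_inv_sub μ hz).mul_const (recip μ z)
  have i3 := (integrable_inv_sub μ hw).mul_const (recip μ w)
  have ee := int_combo i1 i2 ((integrable_const (1 : ℂ)).sub i3)
  simp only [Pi.sub_apply] at ee
  have e3 : ∀ u : ℝ, ((z - (u : ℂ))⁻¹ * (w - (u : ℂ))⁻¹) *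
      (recip μ z * recip μ w) - (z - (u : ℂ))⁻¹ * recip μ z - (w - (u : ℂ))⁻¹ * recip μ w + 1
      = ((z - (u : ℂ))⁻¹ * (w - (u : ℂ))⁻¹) *
      (recip μ z * recip μ w) - (z - (u : ℂ))⁻¹ * recip μ z +
        (1 - (w - (u : ℂ))⁻¹ * recip μ w) := fun u => by ring
  simp_rw [e3]
  rw [ee, integral_sub (integrable_const _) i3, integral_mul_const, integral_mul_const, integral_mul_const]
  have c1 : ∫ u : ℝ, (z - (u : ℂ))⁻¹ ∂μ = cauchy μ z := rfl
  have c2 : ∫ u : ℝ, (w - (u : ℂ))⁻¹ ∂μ = cauchy μ w := rfl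
  rw [c1, c2]
  have h1 := cauchy_ne μ hz
  have h2 := cauchy_ne μ hw
  have h3 := cauchy_sub μ hz hw
  set I := ∫ u : ℝ, (z - (u : ℂ))⁻¹ * (w - (u : ℂ))⁻¹ ∂μ
  unfold hh recip
  simp
  field_simp
  linear_combination -h3

lemma hh_im (μ : Measure ℝ) [IsProbabilityMeasure μ] {z : ℂ} (hz : 0 < z.im) :
    (hh μ z).im = z.im * ∫ u, ‖phi μ z u‖ ^ 2 ∂μ := by
  have e : ∀ u : ℝ, ‖phi μ z u‖ ^ 2 = ‖(z - (u : ℂ))⁻¹‖ ^ 2 * ‖recip μ z‖ ^ 2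
      - 2 * ((z - (u : ℂ))⁻¹ * recip μ z).re + 1 := by
    intro u
    unfold phi
    rw [← mul_pow, ← norm_mul, ← Complex.normSq_eq_norm_sq, ← Complex.normSq_eq_norm_sq,
      Complex.normSq_apply, Complex.normSq_apply]
    simp only [Complex.sub_re, Complex.sub_im, Complex.one_re, Complex.one_im]
    ring
  simp_rw [e]
  have i1 := (integrable_sq μ hz).mul_const (‖recip μ z‖ ^ 2)
  have i2' := (integrable_inv_sub μ hz).mul_const (recip μ z)
  have i2 := i2'.re.const_mul 2
  have e2 : ∫ u : ℝ, ((z - (u : ℂ))⁻¹ * recip μ z).re ∂μ = 1 := by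
    have := integral_re (μ := μ) i2'
    have h3 : ∫ u : ℝ, ((z - (u : ℂ))⁻¹ * recip μ z).re ∂μ
      = (∫ u : ℝ, ((z - (u : ℂ))⁻¹ * recip μ z) ∂μ).re := this
    rw [h3, integral_mul_const]
    have c1 : ∫ u : ℝ, (z - (u : ℂ))⁻¹ ∂μ = cauchy μ z := rfl
    rw [c1, recip, mul_inv_cancel₀ (cauchy_ne μ hz)]; simp
  have i2'' : Integrable (fun u : ℝ => 2 * ((z - (u : ℂ))⁻¹ * recip μ z).re) μ := i2
  rw [int_combo i1 i2'' (integrable_const _), integral_mul_const,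
    integral_const_mul, e2]
  have h3 := cauchy_im μ hz
  have h1 := cauchy_ne μ hz
  set I := ∫ u : ℝ, ‖(z - (u : ℂ))⁻¹‖ ^ 2 ∂μ
  unfold hh recip
  rw [Complex.sub_im, Complex.inv_im, norm_inv, inv_pow, ← Complex.normSq_eq_norm_sq, h3]
  simp
  ring

lemma hh_im_nonneg (μ : Measure ℝ) [IsProbabilityMeasure μ] {z : ℂ} (hz : 0 < z.im) :
    0 ≤ (hh μ z).im := by
  rw [hh_im μ hz]
  exact mul_nonneg hz.le (integral_nonneg fun u => by positivity)

lemma im_le_recip (μ : Measure ℝ) [IsProbabilityMeasure μ] {z : ℂ} (hz : 0 < z.im) :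
    z.im ≤ (recip μ z).im := by
  have := hh_im_nonneg μ hz
  unfold hh at this
  simp at this
  linarith

lemma pick (μ : Measure ℝ) [IsProbabilityMeasure μ] {z w : ℂ} (hz : 0 < z.im) (hw : 0 < w.im) :
    ‖hh μ z - hh μ w‖ ^ 2 * (z.im * w.im) ≤ ‖z - w‖ ^ 2 * ((hh μ z).im * (hh μ w).im) := by
  obtain ⟨C, hC0, hC⟩ := phi_bdd μ hz
  obtain ⟨D, hD0, hD⟩ := phi_bdd μ hw
  have cz := (phi_cont μ hz).norm
  have cw := (phi_cont μ hw).norm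
  have i1 : Integrable (fun u => ‖phi μ z u‖ ^ 2) μ :=
    integrable_of_bdd μ (cz.pow 2) (C ^ 2) fun u => by
      rw [norm_pow, norm_norm]; exact pow_le_pow_left₀ (norm_nonneg _) (hC u) 2
  have i2 : Integrable (fun u => ‖phi μ w u‖ ^ 2) μ :=
    integrable_of_bdd μ (cw.pow 2) (D ^ 2) fun u => by
      rw [norm_pow, norm_norm]; exact pow_le_pow_left₀ (norm_nonneg _) (hD u) 2
  have i3 : Integrable (fun u => ‖phi μ z u‖ * ‖phi μ w u‖) μ :=
    integrable_of_bdd μ (cz.mul cw) (C * D) fun u => by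
      rw [norm_mul, norm_norm, norm_norm]
      exact mul_le_mul (hC u) (hD u) (norm_nonneg _) hC0
  set A := ∫ u, ‖phi μ z u‖ ^ 2 ∂μ with hA
  set B := ∫ u, ‖phi μ w u‖ ^ 2 ∂μ with hB
  set M := ∫ u, ‖phi μ z u‖ * ‖phi μ w u‖ ∂μ with hM
  have hM0 : 0 ≤ M := integral_nonneg fun u => by positivity
  have q : ∀ x : ℝ, 0 ≤ A * (x * x) + (-2 * M) * x + B := by
    intro x
    have h0 : 0 ≤ ∫ u, (‖phi μ z u‖ * x - ‖phi μ w u‖) ^ 2 ∂μ :=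
      integral_nonneg fun u => by positivity
    have e : ∀ u, (‖phi μ z u‖ * x - ‖phi μ w u‖) ^ 2 = ‖phi μ z u‖ ^ 2 * (x * x)
      - (‖phi μ z u‖ * ‖phi μ w u‖) * (2 * x) + ‖phi μ w u‖ ^ 2 := fun u => by ring
    simp_rw [e] at h0
    rw [int_combo (i1.mul_const _) (i3.mul_const _) i2, integral_mul_const, integral_mul_const] at h0
    rw [← hA, ← hB, ← hM] at h0
    linarith
  have d := discrim_le_zero q
  unfold discrim at d
  have hMAB : M ^ 2 ≤ A * B := by nlinarith
  rw [hh_im μ hz, hh_im μ hw, hh_sub μ hz hw, norm_mul, mul_pow]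
  have hI : ‖∫ u, phi μ z u * phi μ w u ∂μ‖ ≤ M := by
    refine (norm_integral_le_integral_norm _).trans_eq ?_
    simp_rw [norm_mul]; rfl
  have hI2 : ‖∫ u, phi μ z u * phi μ w u ∂μ‖ ^ 2 ≤ A * B :=
    (pow_le_pow_left₀ (norm_nonneg _) hI 2).trans hMAB
  calc _ = (‖z - w‖ ^ 2 * (z.im * w.im)) * ‖∫ u, phi μ z u * phi μ w u ∂μ‖ ^ 2 := by ring
    _ ≤ (‖z - w‖ ^ 2 * (z.im * w.im)) * (A * B) := by gcongr
    _ = _ := by rw [← hA, ← hB]; ring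

/-- `y G(iy) -> -i`, in the form `h(iy)/y -> 0`. -/
lemma cauchy_asymp (μ : Measure ℝ) [IsProbabilityMeasure μ] :
    Tendsto (fun y : ℝ => ((y : ℂ) * I) * cauchy μ ((y : ℂ) * I)) atTop (𝓝 1) := by
  have : Tendsto (fun y : ℝ => ∫ u : ℝ, ((y : ℂ) * I) * ((y : ℂ) * I - (u : ℂ))⁻¹ ∂μ) atTop
      (𝓝 (∫ u : ℝ, (1 : ℂ) ∂μ)) := by
    refine tendsto_integral_filter_of_dominated_convergence (fun _ => 1) ?_ ?_
      (integrable_const _) ?_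
    · filter_upwards [eventually_gt_atTop 0] with y hy
      exact (continuous_const.mul (continuous_inv_sub (by simpa using hy))).aestronglyMeasurable
    · filter_upwards [eventually_gt_atTop 0] with y hy
      refine Eventually.of_forall fun u => ?_
      have hy' : 0 < ((y : ℂ) * I).im := by simpa using hy
      have := norm_inv_sub_le hy' u
      rw [norm_mul]
      have e : ‖(y : ℂ) * I‖ = y := by simp [abs_of_pos hy]
      rw [e]
      simp at this
      calc y * _ ≤ y * y⁻¹ := by simp; gcongr
        _ = 1 := mul_inv_cancel₀ hy.ne'
    · refine Eventually.of_forall fun u => ?_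
      have h1 : Tendsto (fun y : ℝ => (1 - (u : ℂ) * ((y⁻¹ : ℝ) : ℂ) * (-I))⁻¹) atTop (𝓝 1) := by
        have h2 : Tendsto (fun y : ℝ => ((y⁻¹ : ℝ) : ℂ)) atTop (𝓝 ((0 : ℝ) : ℂ)) :=
          (Complex.continuous_ofReal.tendsto 0).comp tendsto_inv_atTop_zero
        have h3 := ((h2.const_mul (u : ℂ)).mul_const (-I)).const_sub 1
        have h4 := h3.inv₀ (by simp)
        simpa using h4
      refine h1.congr' ?_
      filter_upwards [eventually_gt_atTop 0] with y hy
      have hy' : 0 < ((y : ℂ) * I).im := by simpa using hy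
      have h5 := sub_ofReal_ne hy' u
      have hyc : (y : ℂ) ≠ 0 := by exact_mod_cast hy.ne'
      rw [← div_eq_mul_inv, inv_eq_one_div, div_eq_div_iff ?_ h5]
      · push_cast
        field_simp
        linear_combination (-(u : ℂ) ) * I_sq
      · intro h6
        apply h5
        push_cast at h6
        have : (y : ℂ) * I * (1 - (u : ℂ) * (y : ℂ)⁻¹ * (-I)) = (y : ℂ) * I - u := by
          field_simp
          linear_combination (u : ℂ) * I_sq
        rw [← this, h6, mul_zero]
  simp only [integral_const_mul] at this
  simpa [cauchy] using this

lemma recip_asymp (μ : Measure ℝ) [IsProbabilityMeasure μ] :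
    Tendsto (fun y : ℝ => ‖hh μ ((y : ℂ) * I)‖ / y) atTop (𝓝 0) := by
  have h := (((cauchy_asymp μ).inv₀ one_ne_zero).sub_const 1).norm
  simp only [inv_one, sub_self, norm_zero] at h
  refine h.congr' ?_
  filter_upwards [eventually_gt_atTop 0] with y hy
  have hyc : (y : ℂ) * I ≠ 0 := mul_ne_zero (by exact_mod_cast hy.ne') I_ne_zero
  have e : ‖(y : ℂ) * I‖ = y := by simp [abs_of_pos hy]
  have : ((y : ℂ) * I * cauchy μ ((y : ℂ) * I))⁻¹ - 1 = hh μ ((y : ℂ) * I) / ((y : ℂ) * I) := by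
    unfold hh recip
    rw [sub_div, div_self hyc, mul_inv, div_eq_mul_inv, mul_comm]
  rw [this, norm_div, e]

section

/-- Abstract Pick-class function. -/
structure PickFn (k : ℂ → ℂ) : Prop where
  diff : ∀ z : ℂ, 0 < z.im → DifferentiableAt ℂ k z
  nn : ∀ z : ℂ, 0 < z.im → 0 ≤ (k z).im
  pick : ∀ z w : ℂ, 0 < z.im → 0 < w.im →
    ‖k z - k w‖ ^ 2 * (z.im * w.im) ≤ ‖z - w‖ ^ 2 * ((k z).im * (k w).im)
  asymp : Tendsto (fun y : ℝ => ‖k ((y : ℂ) * I)‖ / y) atTop (𝓝 0)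

lemma pickFn_hh (μ : Measure ℝ) [IsProbabilityMeasure μ] (c : ℝ) (hc : 0 ≤ c) :
    PickFn (fun w => (c : ℂ) * hh μ w) where
  diff z hz := (hh_differentiableAt μ hz).const_mul _
  nn z hz := by
    simpa using mul_nonneg hc (hh_im_nonneg μ hz)
  pick z w hz hw := by
    have := pick μ hz hw
    rw [← mul_sub, norm_mul, mul_pow]
    simp only [Complex.im_ofReal_mul]
    have e : ‖(c : ℂ)‖ ^ 2 = c ^ 2 := by simp
    rw [e]
    calc _ = c ^ 2 * (‖hh μ z - hh μ w‖ ^ 2 * (z.im * w.im)) := by ring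
      _ ≤ c ^ 2 * (‖z - w‖ ^ 2 * ((hh μ z).im * (hh μ w).im)) := by gcongr
      _ = _ := by ring
  asymp := by
    have := (recip_asymp μ).const_mul c
    rw [mul_zero] at this
    refine this.congr fun y => ?_
    rw [norm_mul, Complex.norm_real, Real.norm_of_nonneg hc]
    ring

variable {k : ℂ → ℂ}

lemma PickFn.exists_R (hk : PickFn k) : ∃ R : ℝ, 0 < R ∧ (k ((R : ℂ) * I)).im < R := by
  have h1 := (hk.asymp.eventually (gt_mem_nhds (zero_lt_one))).and (eventually_gt_atTop (0 : ℝ))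
  obtain ⟨R, hR, hR0⟩ := h1.exists
  refine ⟨R, hR0, ?_⟩
  rw [div_lt_one hR0] at hR
  exact (Complex.im_le_norm _).trans_lt hR

lemma PickFn.fixed (hk : PickFn k) {z : ℂ} (hz : 0 < z.im) :
    ∃ w : ℂ, 0 < w.im ∧ z + k w = w := by
  obtain ⟨R, hR, hkR⟩ := hk.exists_R
  set w0 : ℂ := (R : ℂ) * I with hw0
  have hw0im : w0.im = R := by simp [hw0]
  set q := k w0 with hq
  set b := q.im with hb
  have hb0 : 0 ≤ b := hk.nn w0 (by rw [hw0im]; exact hR)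
  set θ := (R - b) / R with hθ
  have hθ0 : 0 < θ := div_pos (by linarith) hR
  have hθb : (1 + θ) * b ≤ R := by
    have : θ * b ≤ R - b := by
      rw [hθ, div_mul_eq_mul_div, div_le_iff₀ hR]
      nlinarith
    linarith
  set d := z + q - w0 with hd
  set C := (1 + 1 / θ) * ‖d‖ ^ 2 / z.im + 1 with hC
  have hC0 : 0 < C := by positivity
  have hCy : (1 + 1 / θ) * ‖d‖ ^ 2 ≤ C * z.im := by
    have : C * z.im = (1 + 1 / θ) * ‖d‖ ^ 2 + z.im := by rw [hC]; field_simp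
    linarith
  set D : Set ℂ := {w | ‖w - w0‖ ^ 2 ≤ C * w.im} with hD
  have hDim : ∀ w ∈ D, 0 < w.im := by
    intro w hw
    have hw' : ‖w - w0‖ ^ 2 ≤ C * w.im := hw
    have h1 : 0 ≤ C * w.im := (by positivity : (0 : ℝ) ≤ ‖w - w0‖ ^ 2).trans hw'
    have h2 : 0 ≤ w.im := nonneg_of_mul_nonneg_right h1 hC0
    rcases h2.lt_or_eq with h | h
    · exact h
    · exfalso
      rw [← h, mul_zero] at hw'
      have : ‖w - w0‖ = 0 := by
        have := norm_nonneg (w - w0)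
        nlinarith
      rw [norm_eq_zero, sub_eq_zero] at this
      rw [this, hw0im] at h
      linarith
  have hDclosed : IsClosed D :=
    isClosed_le (by fun_prop) (continuous_const.mul Complex.continuous_im)
  have hDbdd : Bornology.IsBounded D := by
    refine (Metric.isBounded_closedBall (x := w0) (r := C + R + 1)).subset fun w hw => ?_
    have hw' : ‖w - w0‖ ^ 2 ≤ C * w.im := hw
    rw [Metric.mem_closedBall, dist_eq_norm]
    have h3 : w.im ≤ ‖w - w0‖ + R := by
      have := Complex.im_le_norm (w - w0)
      rw [Complex.sub_im, hw0im] at this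
      linarith
    have h4 : ‖w - w0‖ ^ 2 ≤ C * (‖w - w0‖ + R) := hw'.trans (by gcongr)
    by_contra h
    push Not at h
    nlinarith
  have hDc : IsCompact D := Metric.isCompact_of_isClosed_isBounded hDclosed hDbdd
  have hDne : D.Nonempty := ⟨w0, by
    change ‖w0 - w0‖ ^ 2 ≤ C * w0.im
    rw [hw0im]; simp; positivity⟩
  have hmaps : ∀ w ∈ D, z + k w ∈ D := by
    intro w hw
    have hwim := hDim w hw
    have hw' : ‖w - w0‖ ^ 2 ≤ C * w.im := hw
    have hp0 := hk.nn w hwim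
    have h1 := hk.pick w w0 hwim (by rw [hw0im]; exact hR)
    rw [hw0im, ← hq, ← hb] at h1
    have h2 : ‖k w - q‖ ^ 2 * R ≤ C * ((k w).im * b) := by
      have h3 : (‖k w - q‖ ^ 2 * R) * w.im ≤ (C * ((k w).im * b)) * w.im := by
        calc _ = ‖k w - q‖ ^ 2 * (w.im * R) := by ring
          _ ≤ _ := h1
          _ ≤ (C * w.im) * ((k w).im * b) := by gcongr
          _ = _ := by ring
      exact le_of_mul_le_mul_right h3 hwim
    change ‖z + k w - w0‖ ^ 2 ≤ C * (z + k w).im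
    have e : z + k w - w0 = (k w - q) + d := by rw [hd]; ring
    rw [e, Complex.add_im]
    have h4 : ‖(k w - q) + d‖ ^ 2 ≤ (1 + θ) * ‖k w - q‖ ^ 2 + (1 + 1 / θ) * ‖d‖ ^ 2 := by
      have t1 := pow_le_pow_left₀ (norm_nonneg _) (norm_add_le (k w - q) d) 2
      refine t1.trans ?_
      have t2 : 0 ≤ (θ * ‖k w - q‖ - ‖d‖) ^ 2 / θ := by positivity
      have t3 : (θ * ‖k w - q‖ - ‖d‖) ^ 2 / θ
        = θ * ‖k w - q‖ ^ 2 - 2 * ‖k w - q‖ * ‖d‖ + 1 / θ * ‖d‖ ^ 2 := by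
        field_simp; ring
      nlinarith
    have h5 : (1 + θ) * ‖k w - q‖ ^ 2 ≤ C * (k w).im := by
      have h6 : ((1 + θ) * ‖k w - q‖ ^ 2) * R ≤ (C * (k w).im) * R := by
        calc _ = (1 + θ) * (‖k w - q‖ ^ 2 * R) := by ring
          _ ≤ (1 + θ) * (C * ((k w).im * b)) := by gcongr
          _ = (C * (k w).im) * ((1 + θ) * b) := by ring
          _ ≤ _ := by gcongr
      exact le_of_mul_le_mul_right h6 hR
    linarith
  have hkc : ContinuousOn k D := fun w hw => (hk.diff w (hDim w hw)).continuousAt.continuousWithinAt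
  have hfim : ∀ w ∈ D, 0 < (z + k w).im := fun w hw => hDim _ (hmaps w hw)
  have hψ : ContinuousOn (fun w => ‖z + k w - w‖ ^ 2 / ((z + k w).im * w.im)) D := by
    refine ContinuousOn.div ?_ ?_ ?_
    · exact (((continuousOn_const.add hkc).sub continuousOn_id).norm.pow 2)
    · exact (Complex.continuous_im.comp_continuousOn (continuousOn_const.add hkc)).mul
        Complex.continuous_im.continuousOn
    · intro w hw
      exact (mul_pos (hfim w hw) (hDim w hw)).ne'
  obtain ⟨w, hwD, hmin⟩ := hDc.exists_isMinOn hDne hψ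
  refine ⟨w, hDim w hwD, ?_⟩
  by_contra hne
  set w' := z + k w with hw'
  have hw'D := hmaps w hwD
  rw [← hw'] at hw'D
  have h1 := hmin hw'D
  simp only [Set.mem_ofPred_eq] at h1
  rw [← hw'] at h1
  have p := hk.pick w' w (hDim _ hw'D) (hDim _ hwD)
  have e : z + k w' - w' = k w' - k w := by rw [hw']; ring
  rw [e] at h1
  have v1 := hDim _ hwD
  have v2 := hDim _ hw'D
  have v3 := hfim _ hw'D
  have n1 := hk.nn _ v1
  have n2 := hk.nn _ v2
  have hpos : 0 < ‖w' - w‖ ^ 2 := by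
    have : 0 < ‖w' - w‖ := norm_pos_iff.2 (sub_ne_zero.2 hne)
    positivity
  have e1 : w'.im = z.im + (k w).im := by rw [hw']; simp
  have e2 : (z + k w').im = z.im + (k w').im := by simp
  rw [div_le_div_iff₀ (by positivity) (by positivity)] at h1
  have h2 : (k w').im * (k w).im < (z + k w').im * w'.im := by
    rw [e1, e2]; nlinarith
  have h3 := mul_lt_mul_of_pos_left h2 hpos
  nlinarith

lemma PickFn.stab (hk : PickFn k) {w1 w2 : ℂ} (h1 : 0 < w1.im) (h2 : 0 < w2.im)
    (g1 : 0 < (w1 - k w1).im) (g2 : 0 < (w2 - k w2).im) :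
    (w1 - k w1).im * ‖w1 - w2‖ ≤ 2 * w1.im * ‖(w1 - k w1) - (w2 - k w2)‖ := by
  have p := hk.pick w1 w2 h1 h2
  have n1 := hk.nn _ h1
  have n2 := hk.nn _ h2
  set y := (w1 - k w1).im with hy
  have e1 : (k w1).im = w1.im - y := by rw [hy]; simp
  have e2 : (k w2).im ≤ w2.im := by rw [Complex.sub_im] at g2; linarith
  have p1 : ‖k w1 - k w2‖ ^ 2 * w1.im ≤ ‖w1 - w2‖ ^ 2 * (w1.im - y) := by
    refine le_of_mul_le_mul_right ?_ h2
    calc _ = ‖k w1 - k w2‖ ^ 2 * (w1.im * w2.im) := by ring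
      _ ≤ _ := p
      _ ≤ ‖w1 - w2‖ ^ 2 * ((k w1).im * w2.im) := by gcongr
      _ = _ := by rw [e1]; ring
  have hyv : y ≤ w1.im := by linarith
  have p2 : ‖k w1 - k w2‖ * (2 * w1.im) ≤ ‖w1 - w2‖ * (2 * w1.im - y) := by
    refine (pow_le_pow_iff_left₀ (by positivity) (mul_nonneg (norm_nonneg _) (by linarith)) two_ne_zero).1 ?_
    have := mul_le_mul_of_nonneg_left p1 (by linarith : 0 ≤ 4 * w1.im)
    have s := mul_nonneg (sq_nonneg ‖w1 - w2‖) (sq_nonneg y)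
    nlinarith
  have tri : ‖w1 - w2‖ ≤ ‖(w1 - k w1) - (w2 - k w2)‖ + ‖k w1 - k w2‖ := by
    have := norm_add_le ((w1 - k w1) - (w2 - k w2)) (k w1 - k w2)
    have e : ((w1 - k w1) - (w2 - k w2)) + (k w1 - k w2) = w1 - w2 := by ring
    rwa [e] at this
  have := mul_le_mul_of_nonneg_left tri (by linarith : 0 ≤ 2 * w1.im)
  linarith

lemma PickFn.uniq (hk : PickFn k) {z w1 w2 : ℂ} (hz : 0 < z.im) (h1 : 0 < w1.im) (h2 : 0 < w2.im)
    (g1 : z + k w1 = w1) (g2 : z + k w2 = w2) : w1 = w2 := by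
  have e1 : w1 - k w1 = z := by rw [← eq_sub_iff_add_eq] at g1; exact g1.symm
  have e2 : w2 - k w2 = z := by rw [← eq_sub_iff_add_eq] at g2; exact g2.symm
  have := hk.stab h1 h2 (by rw [e1]; exact hz) (by rw [e2]; exact hz)
  rw [e1, e2, sub_self, norm_zero, mul_zero] at this
  have h3 : ‖w1 - w2‖ ≤ 0 := by
    by_contra h
    push Not at h
    have := mul_pos hz h
    linarith
  exact sub_eq_zero.1 (norm_le_zero_iff.1 h3)

/-- Existence of the holomorphic solution. -/
lemma PickFn.main (hk : PickFn k) : ∃ Z : ℂ → ℂ, (∀ z : ℂ, 0 < z.im →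
    z.im ≤ (Z z).im ∧ z + k (Z z) = Z z ∧ DifferentiableAt ℂ Z z) ∧
    Tendsto (fun y : ℝ => ‖Z ((y : ℂ) * I) - (y : ℂ) * I‖ / y) atTop (𝓝 0) := by
  have hex : ∀ z : ℂ, ∃ w : ℂ, 0 < z.im → (0 < w.im ∧ z + k w = w) := by
    intro z
    by_cases hz : 0 < z.im
    · obtain ⟨w, hw⟩ := hk.fixed hz
      exact ⟨w, fun _ => hw⟩
    · exact ⟨0, fun h => absurd h hz⟩
  choose Z hZ using hex
  have hle : ∀ z : ℂ, 0 < z.im → z.im ≤ (Z z).im := by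
    intro z hz
    obtain ⟨h1, h2⟩ := hZ z hz
    have := congrArg Complex.im h2
    rw [Complex.add_im] at this
    linarith [hk.nn _ h1]
  have hinv : ∀ z : ℂ, 0 < z.im → Z z - k (Z z) = z := by
    intro z hz
    have := (hZ z hz).2
    rw [← eq_sub_iff_add_eq] at this
    exact this.symm
  have hopen : ∀ z : ℂ, 0 < z.im → ∀ᶠ w in 𝓝 z, 0 < w.im := fun z hz =>
    (isOpen_lt continuous_const Complex.continuous_im).mem_nhds hz
  refine ⟨Z, fun z hz => ⟨hle z hz, (hZ z hz).2, ?_⟩, ?_⟩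
  · have hv : 0 < (Z z).im := (hZ z hz).1
    have hcont : ContinuousAt Z z := by
      rw [ContinuousAt, tendsto_iff_norm_sub_tendsto_zero]
      have hlim : Tendsto (fun x : ℂ => 2 * (Z z).im * ‖z - x‖ / z.im) (𝓝 z) (𝓝 0) := by
        have : Continuous (fun x : ℂ => 2 * (Z z).im * ‖z - x‖ / z.im) := by fun_prop
        simpa using this.tendsto z
      refine squeeze_zero' (Eventually.of_forall fun _ => norm_nonneg _) ?_ hlim
      filter_upwards [hopen z hz] with x hx
      have s := hk.stab hv (hZ x hx).1 (by rw [hinv z hz]; exact hz) (by rw [hinv x hx]; exact hx)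
      rw [hinv z hz, hinv x hx] at s
      rw [norm_sub_rev, le_div_iff₀ hz]
      linarith
    have hH : HasDerivAt (fun w => w - k w) (1 - deriv k (Z z)) (Z z) :=
      (hasDerivAt_id _).sub (hk.diff _ hv).hasDerivAt
    have hne : 1 - deriv k (Z z) ≠ 0 := by
      have hs := (hasDerivAt_iff_tendsto_slope.1 hH).norm
      have hb : z.im / (2 * (Z z).im) ≤ ‖1 - deriv k (Z z)‖ := by
        refine ge_of_tendsto hs ?_
        have hev : ∀ᶠ w in 𝓝 (Z z), 0 < (w - k w).im := by
          have : ContinuousAt (fun w => w - k w) (Z z) := hH.continuousAt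
          refine this.eventually (p := fun w : ℂ => 0 < w.im) (hopen _ ?_)
          simpa only [hinv z hz] using hz
        rw [eventually_nhdsWithin_iff]
        filter_upwards [hev, hopen _ hv] with w hw1 hw2 hw3
        have s := hk.stab hv hw2 (by rw [hinv z hz]; exact hz) hw1
        rw [hinv z hz] at s
        have hpos : 0 < ‖w - Z z‖ := norm_pos_iff.2 (sub_ne_zero.2 hw3)
        rw [slope_def_field, norm_div, div_le_div_iff₀ (by positivity) hpos, hinv z hz,
          norm_sub_rev w, norm_sub_rev _ z]
        linarith
      intro h0
      rw [h0, norm_zero] at hb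
      have : 0 < z.im / (2 * (Z z).im) := by positivity
      linarith
    refine (HasDerivAt.of_local_left_inverse hcont hH hne ?_).differentiableAt
    filter_upwards [hopen z hz] with x hx using hinv x hx
  · have h2 := hk.asymp.const_mul 2
    rw [mul_zero] at h2
    have hpos : ∀ᶠ y : ℝ in atTop, 0 ≤ ‖Z ((y : ℂ) * I) - (y : ℂ) * I‖ / y := by
      filter_upwards [eventually_gt_atTop 0] with y hy
      positivity
    refine squeeze_zero' hpos ?_ h2
    filter_upwards [eventually_gt_atTop 0, hk.asymp.eventually (gt_mem_nhds (by norm_num : (0:ℝ) < 1/4))]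
      with y hy hlt
    set z : ℂ := (y : ℂ) * I with hzdef
    have hzy : z.im = y := by simp [hzdef]
    have hz : 0 < z.im := by rw [hzy]; exact hy
    obtain ⟨hv, hfix⟩ := hZ z hz
    have hlez := hle z hz
    have p := hk.pick _ z hv hz
    have n1 := hk.nn _ hv
    have n2 := hk.nn _ hz
    have e : Z z - z = k (Z z) := by linear_combination -hfix
    have hkv : (k (Z z)).im ≤ (Z z).im := by
      have := congrArg Complex.im e
      rw [Complex.sub_im] at this; linarith
    rw [div_lt_iff₀ hy] at hlt
    have hki : (k z).im ≤ 1/4 * y := (Complex.im_le_norm _).trans hlt.le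
    have p1 : ‖k (Z z) - k z‖ ^ 2 ≤ (‖Z z - z‖ / 2) ^ 2 := by
      have : ‖k (Z z) - k z‖ ^ 2 * ((Z z).im * y) ≤ (‖Z z - z‖ / 2) ^ 2 * ((Z z).im * y) := by
        calc _ = ‖k (Z z) - k z‖ ^ 2 * ((Z z).im * z.im) := by rw [hzy]
          _ ≤ _ := p
          _ ≤ ‖Z z - z‖ ^ 2 * ((Z z).im * (1/4 * y)) := by gcongr
          _ = _ := by ring
      exact le_of_mul_le_mul_right this (by positivity)
    have p2 := (pow_le_pow_iff_left₀ (norm_nonneg _) (by positivity) two_ne_zero).1 p1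
    have p3 : ‖Z z - z‖ ≤ ‖k (Z z) - k z‖ + ‖k z‖ := by
      nth_rewrite 1 [e]
      have := norm_add_le (k (Z z) - k z) (k z)
      simpa using this
    rw [← mul_div_assoc]
    gcongr
    linarith

end

lemma norm_sq_inv {z : ℂ} (hz : 0 < z.im) (t : ℝ) :
    ‖(z - (t : ℂ))⁻¹‖ ^ 2 = (z.im ^ 2)⁻¹ * (1 + ((t - z.re) / z.im) ^ 2)⁻¹ := by
  rw [norm_inv, inv_pow, ← Complex.normSq_eq_norm_sq, ← mul_inv, Complex.normSq_apply]
  congr 1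
  simp
  field_simp
  ring

lemma integrable_poisson {z : ℂ} (hz : 0 < z.im) :
    Integrable (fun t : ℝ => ‖(z - (t : ℂ))⁻¹‖ ^ 2) := by
  simp_rw [norm_sq_inv hz]
  have h1 := integrable_inv_one_add_sq.comp_div hz.ne'
  exact (h1.comp_sub_right z.re).const_mul _

lemma integral_poisson {z : ℂ} (hz : 0 < z.im) :
    ∫ t : ℝ, ‖(z - (t : ℂ))⁻¹‖ ^ 2 = Real.pi / z.im := by
  simp_rw [norm_sq_inv hz]
  rw [integral_const_mul, integral_sub_right_eq_self (fun t : ℝ => (1 + (t / z.im) ^ 2)⁻¹) z.re,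
    Measure.integral_comp_div (fun t : ℝ => (1 + t ^ 2)⁻¹) z.im, integral_univ_inv_one_add_sq,
    abs_of_pos hz, smul_eq_mul]
  field_simp

lemma integrable_mul_poisson {E : Type*} [NormedRing E] [NormedSpace ℝ E]
    [SecondCountableTopologyEither ℝ E] {g : ℝ → E} (hg : Continuous g) {M : ℝ}
    (hM : ∀ t, ‖g t‖ ≤ M) {z : ℂ} (hz : 0 < z.im) :
    Integrable (fun t : ℝ => ‖(z - (t : ℂ))⁻¹‖ ^ 2 • g t) :=
  (integrable_poisson hz).smul_bdd M hg.aestronglyMeasurable (Eventually.of_forall hM)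

lemma poisson {g : ℂ → ℂ} {ε M : ℝ} (hε : 0 < ε)
    (hg : ∀ w : ℂ, -ε < w.im → DifferentiableAt ℂ g w)
    (hM : ∀ w : ℂ, 0 ≤ w.im → ‖g w‖ ≤ M) {z : ℂ} (hz : 0 < z.im) :
    ∫ t : ℝ, ‖(z - (t : ℂ))⁻¹‖ ^ 2 • g t = (Real.pi / z.im) • g z := by
  have hM0 : 0 ≤ M := (norm_nonneg _).trans (hM z hz.le)
  set zb : ℂ := (starRingEnd ℂ) z with hzb
  have hzbim : zb.im = - z.im := by simp [hzb]
  set k : ℂ → ℂ := fun w => dslope g z w * (w - zb)⁻¹ with hk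
  set U : Set ℂ := {w | -ε < w.im} with hU
  have hUo : IsOpen U := isOpen_lt continuous_const Complex.continuous_im
  have hgU : DifferentiableOn ℂ g U := fun w hw => (hg w hw).differentiableWithinAt
  have hzU : U ∈ 𝓝 z := hUo.mem_nhds (by change -ε < z.im; linarith)
  have hds : DifferentiableOn ℂ (dslope g z) U := (Complex.differentiableOn_dslope hzU).2 hgU
  have hne : ∀ w : ℂ, 0 ≤ w.im → w - zb ≠ 0 := by
    intro w hw h
    have := congrArg Complex.im h
    rw [Complex.sub_im, hzbim] at this
    simp at this
    linarith
  have hkd : ∀ w : ℂ, 0 ≤ w.im → DifferentiableAt ℂ k w := by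
    intro w hw
    have h1 : DifferentiableAt ℂ (dslope g z) w :=
      hds.differentiableAt (hUo.mem_nhds (by change -ε < w.im; linarith))
    have h2 : DifferentiableAt ℂ (fun w => (w - zb)⁻¹) w :=
      (differentiableAt_id.sub_const _).inv (hne w hw)
    exact h1.mul h2
  have hkt : ∀ t : ℝ, k t = ‖(z - (t : ℂ))⁻¹‖ ^ 2 • (g t - g z) := by
    intro t
    have htz : (t : ℂ) ≠ z := by
      intro h; exact sub_ofReal_ne hz t (by rw [h, sub_self])
    have h1 : (t : ℂ) - z ≠ 0 := sub_ne_zero.2 htz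
    have h2 : (t : ℂ) - zb = (starRingEnd ℂ) ((t : ℂ) - z) := by simp [hzb]
    rw [hk]
    simp only
    rw [dslope_of_ne _ htz, slope_def_field, h2, norm_inv, norm_sub_rev]
    rw [Complex.real_smul]
    push_cast
    rw [inv_pow, ← Complex.mul_conj', mul_inv]
    ring
  have hbound : ∀ w : ℂ, 0 ≤ w.im → ∀ R : ℝ, 0 < R → 2 * ‖z‖ ≤ R → R ≤ ‖w‖ →
      ‖k w‖ ≤ 8 * M / R ^ 2 := by
    intro w hw R hR hzR hRw
    have n1 : R / 2 ≤ ‖w - z‖ := by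
      have := norm_sub_norm_le w z
      linarith
    have n2 : R / 2 ≤ ‖w - zb‖ := by
      have := norm_sub_norm_le w zb
      have e : ‖zb‖ = ‖z‖ := by simp [hzb]
      linarith
    have hwz : w ≠ z := by
      intro h; rw [h, sub_self, norm_zero] at n1; linarith
    rw [hk]
    simp only
    rw [dslope_of_ne _ hwz, slope_def_field, norm_mul, norm_div, norm_inv]
    have n3 : ‖g w - g z‖ ≤ 2 * M := by
      have := norm_sub_le (g w) (g z)
      linarith [hM w hw, hM z hz.le]
    calc ‖g w - g z‖ / ‖w - z‖ * ‖w - zb‖⁻¹ ≤ 2 * M / (R / 2) * (R / 2)⁻¹ := by gcongr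
      _ = _ := by field_simp; ring
  have hint : Integrable (fun t : ℝ => ‖(z - (t : ℂ))⁻¹‖ ^ 2 • (g t - g z)) := by
    refine integrable_mul_poisson (g := fun t : ℝ => g t - g z) (M := 2 * M) ?_ ?_ hz
    · refine Continuous.sub ?_ continuous_const
      rw [continuous_iff_continuousAt]
      intro t
      have h1 : ContinuousAt g (t : ℂ) := (hg t (by simpa using hε)).continuousAt
      exact ContinuousAt.comp (f := fun t : ℝ => (t : ℂ)) h1 Complex.continuous_ofReal.continuousAt
    · intro t
      have := norm_sub_le (g t) (g z)
      linarith [hM t (by simp), hM z hz.le]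
  have hlim := intervalIntegral_tendsto_integral hint tendsto_neg_atTop_atBot tendsto_id
  have hsmall : ∀ᶠ R : ℝ in atTop,
      ‖∫ t in (-R)..R, ‖(z - (t : ℂ))⁻¹‖ ^ 2 • (g t - g z)‖ ≤ 32 * M / R := by
    filter_upwards [eventually_gt_atTop 0, eventually_ge_atTop (2 * ‖z‖)] with R hR hzR
    have hc := Complex.integral_boundary_rect_eq_zero_of_differentiableOn k (-R : ℝ)
      ((R : ℂ) + R * I) ?_
    · simp only [Complex.ofReal_re, Complex.ofReal_im, Complex.add_re, Complex.mul_re,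
        Complex.I_re, Complex.I_im, Complex.add_im, Complex.mul_im, mul_zero, mul_one, zero_add,
        add_zero, sub_zero, Complex.ofReal_zero, zero_mul, hkt] at hc
      have b1 : ‖∫ x in (-R)..R, k (x + R * I)‖ ≤ 8 * M / R ^ 2 * |R - (-R)| := by
        refine intervalIntegral.norm_integral_le_of_norm_le_const fun x _ => ?_
        refine hbound _ (by simpa using hR.le) R hR hzR ?_
        have := Complex.im_le_norm (x + R * I)
        simpa using this
      have b2 : ‖∫ y in (0:ℝ)..R, k (R + y * I)‖ ≤ 8 * M / R ^ 2 * |R - 0| := by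
        refine intervalIntegral.norm_integral_le_of_norm_le_const fun y hy => ?_
        rw [uIoc_of_le hR.le] at hy
        refine hbound _ (by simpa using hy.1.le) R hR hzR ?_
        have := Complex.re_le_norm (R + y * I)
        simpa using this
      have b3 : ‖∫ y in (0:ℝ)..R, k ((-R : ℝ) + y * I)‖ ≤ 8 * M / R ^ 2 * |R - 0| := by
        refine intervalIntegral.norm_integral_le_of_norm_le_const fun y hy => ?_
        rw [uIoc_of_le hR.le] at hy
        refine hbound _ (by simpa using hy.1.le) R hR hzR ?_
        have := Complex.abs_re_le_norm ((-R : ℝ) + y * I)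
        simpa [abs_of_pos hR] using this
      set J := ∫ t in (-R)..R, ‖(z - (t : ℂ))⁻¹‖ ^ 2 • (g t - g z) with hJ
      set J1 := ∫ x in (-R)..R, k (x + R * I)
      set J2 := ∫ y in (0:ℝ)..R, k (R + y * I)
      set J3 := ∫ y in (0:ℝ)..R, k ((-R : ℝ) + y * I)
      have eJ : J = J1 - I • J2 + I • J3 := by linear_combination hc
      rw [eJ]
      have t1 := norm_add_le (J1 - I • J2) (I • J3)
      have t2 := norm_sub_le J1 (I • J2)
      rw [norm_smul, Complex.norm_I, one_mul] at t1 t2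
      rw [sub_neg_eq_add, abs_of_pos (by linarith)] at b1
      rw [sub_zero, abs_of_pos hR] at b2 b3
      have e32 : 32 * M / R = 8 * M / R ^ 2 * (R + R) + 8 * M / R ^ 2 * R + 8 * M / R ^ 2 * R := by
        field_simp; ring
      linarith
    · intro w hw
      refine (hkd w ?_).differentiableWithinAt
      have := hw.2
      simp at this
      rcases this with ⟨h, _⟩
      exact (le_min le_rfl hR.le).trans (by simpa using h)
  have hz0 : ∫ t : ℝ, ‖(z - (t : ℂ))⁻¹‖ ^ 2 • (g t - g z) = 0 := by
    refine tendsto_nhds_unique hlim ?_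
    refine squeeze_zero_norm' hsmall ?_
    exact tendsto_const_nhds.div_atTop tendsto_id
  have hi2 : Integrable (fun t : ℝ => ‖(z - (t : ℂ))⁻¹‖ ^ 2 • g z) :=
    (integrable_poisson hz).smul_const _
  have hfin : ∫ t : ℝ, ‖(z - (t : ℂ))⁻¹‖ ^ 2 • g t
      = ∫ t : ℝ, (‖(z - (t : ℂ))⁻¹‖ ^ 2 • (g t - g z) + ‖(z - (t : ℂ))⁻¹‖ ^ 2 • g z) := by
    congr 1; ext t; rw [smul_sub, sub_add_cancel]
  rw [hfin, integral_add hint hi2, hz0, zero_add, integral_smul_const, integral_poisson hz]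

section

/-- Hypotheses under which `G` is a Cauchy transform. -/
structure CauchyLike (G : ℂ → ℂ) : Prop where
  diff : ∀ z : ℂ, 0 < z.im → DifferentiableAt ℂ G z
  nonpos : ∀ z : ℂ, 0 < z.im → (G z).im ≤ 0
  bdd : ∀ z : ℂ, 0 < z.im → ‖G z‖ ≤ (z.im)⁻¹
  asymp : Tendsto (fun y : ℝ => ((y : ℂ) * I) * G ((y : ℂ) * I)) atTop (𝓝 1)

variable {G : ℂ → ℂ}

lemma CauchyLike.asymp_im (hG : CauchyLike G) :
    Tendsto (fun y : ℝ => -(y * (G ((y : ℂ) * I)).im)) atTop (𝓝 1) := by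
  have := (Complex.continuous_re.tendsto _).comp hG.asymp
  simp only [Complex.one_re] at this
  refine this.congr fun y => ?_
  simp [Complex.mul_re]

lemma CauchyLike.poisson_im (hG : CauchyLike G) {ε : ℝ} (hε : 0 < ε) {z : ℂ} (hz : 0 < z.im) :
    Integrable (fun t : ℝ => ‖(z - (t : ℂ))⁻¹‖ ^ 2 * (-(G (t + ε * I)).im / Real.pi)) ∧
    ∫ t : ℝ, ‖(z - (t : ℂ))⁻¹‖ ^ 2 * (-(G (t + ε * I)).im / Real.pi)
      = -(G (z + ε * I)).im / z.im := by
  have hd : ∀ w : ℂ, -ε < w.im → DifferentiableAt ℂ (fun w => G (w + ε * I)) w := by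
    intro w hw
    have h1 : DifferentiableAt ℂ G (w + ε * I) := hG.diff _ (by simp; linarith)
    exact DifferentiableAt.comp (f := fun w : ℂ => w + ε * I) w h1 (by fun_prop)
  have hb : ∀ w : ℂ, 0 ≤ w.im → ‖G (w + ε * I)‖ ≤ ε⁻¹ := by
    intro w hw
    have him : (w + ε * I).im = w.im + ε := by simp
    refine (hG.bdd _ (by rw [him]; linarith)).trans ?_
    rw [him]
    exact inv_anti₀ hε (by linarith)
  have hp := poisson (g := fun w => G (w + ε * I)) hε hd hb hz
  have hint : Integrable (fun t : ℝ => ‖(z - (t : ℂ))⁻¹‖ ^ 2 • G (t + ε * I)) := by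
    refine integrable_mul_poisson (g := fun t : ℝ => G (t + ε * I)) (M := ε⁻¹) ?_ ?_ hz
    · rw [continuous_iff_continuousAt]
      intro t
      have h1 := (hd t (by simpa using hε)).continuousAt
      exact ContinuousAt.comp (f := fun t : ℝ => (t : ℂ)) h1 Complex.continuous_ofReal.continuousAt
    · intro t; exact hb t (by simp)
  have him : Integrable (fun t : ℝ => ‖(z - (t : ℂ))⁻¹‖ ^ 2 * (G (t + ε * I)).im) := by
    refine hint.im.congr (Eventually.of_forall fun t => ?_)
    simp only [Complex.real_smul, RCLike.im_eq_complex_im, Complex.im_ofReal_mul]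
  have e : ∀ t : ℝ, ‖(z - (t : ℂ))⁻¹‖ ^ 2 * (-(G (t + ε * I)).im / Real.pi)
    = (‖(z - (t : ℂ))⁻¹‖ ^ 2 * (G (t + ε * I)).im) * (-1 / Real.pi) := fun t => by ring
  have hval : ∫ t : ℝ, ‖(z - (t : ℂ))⁻¹‖ ^ 2 * (G (t + ε * I)).im
      = (Real.pi / z.im) * (G (z + ε * I)).im := by
    have h1 := congrArg Complex.im hp
    have h2 := integral_im hint
    simp only [RCLike.im_eq_complex_im] at h2
    rw [← h2, Complex.real_smul, Complex.im_ofReal_mul] at h1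
    rw [← h1]
    congr 1
    ext t
    rw [Complex.real_smul, Complex.im_ofReal_mul]
  simp_rw [e]
  refine ⟨him.mul_const _, ?_⟩
  rw [integral_mul_const, hval]
  have := Real.pi_ne_zero
  field_simp

lemma CauchyLike.approx (hG : CauchyLike G) {ε : ℝ} (hε : 0 < ε) :
    ∃ ν : ProbabilityMeasure ℝ, ∀ z : ℂ, 0 < z.im →
      ∫ t : ℝ, ‖(z - (t : ℂ))⁻¹‖ ^ 2 ∂(ν : Measure ℝ) = -(G (z + ε * I)).im / z.im := by
  set p : ℝ → ℝ := fun t => -(G (t + ε * I)).im / Real.pi with hp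
  have hp0 : ∀ t, 0 ≤ p t := fun t =>
    div_nonneg (neg_nonneg.2 (hG.nonpos _ (by simpa using hε))) Real.pi_pos.le
  have hpc : Continuous p := by
    refine Continuous.div_const (Continuous.neg ?_) _
    refine Complex.continuous_im.comp ?_
    rw [continuous_iff_continuousAt]
    intro t
    have h1 := (hG.diff (t + ε * I) (by simpa using hε)).continuousAt
    exact ContinuousAt.comp (f := fun t : ℝ => (t : ℂ) + ε * I) h1 (by fun_prop)
  have hmass : ∫⁻ t, ENNReal.ofReal (p t) = 1 := by
    have hL := lintegral_tendsto_of_tendsto_of_monotone (μ := volume)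
      (f := fun (n : ℕ) (t : ℝ) =>
        ENNReal.ofReal (((n : ℝ) + 1) ^ 2 / (((n : ℝ) + 1) ^ 2 + t ^ 2) * p t))
      (F := fun t => ENNReal.ofReal (p t)) ?_ ?_ ?_
    · refine tendsto_nhds_unique hL ?_
      have hval : ∀ n : ℕ, ∫⁻ t : ℝ,
          ENNReal.ofReal (((n : ℝ) + 1) ^ 2 / (((n : ℝ) + 1) ^ 2 + t ^ 2) * p t)
          = ENNReal.ofReal (-(((n : ℝ) + 1) * (G (((n + 1 + ε : ℝ) : ℂ) * I)).im)) := by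
        intro n
        set y : ℝ := (n : ℝ) + 1 with hy
        have hy0 : 0 < y := by positivity
        have hz : 0 < ((y : ℂ) * I).im := by simpa using hy0
        obtain ⟨h1, h2⟩ := hG.poisson_im hε hz
        have e : ∀ t : ℝ, y ^ 2 / (y ^ 2 + t ^ 2) * p t
            = y ^ 2 * (‖((y : ℂ) * I - (t : ℂ))⁻¹‖ ^ 2 * p t) := by
          intro t
          rw [norm_sq_inv hz]
          simp
          field_simp
        simp_rw [e]
        rw [← ofReal_integral_eq_lintegral_ofReal (h1.const_mul _)
          (Eventually.of_forall fun t => by have := hp0 t; positivity), integral_const_mul, h2]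
        congr 1
        have e2 : (y : ℂ) * I + ε * I = ((y + ε : ℝ) : ℂ) * I := by push_cast; ring
        rw [e2]
        have e3 : ((y : ℂ) * I).im = y := by simp
        rw [e3]
        field_simp
      simp_rw [hval]
      have h1 : Tendsto (fun n : ℕ => ((n : ℝ) + 1 + ε)) atTop atTop :=
        tendsto_atTop_add_const_right _ _ (tendsto_atTop_add_const_right _ _
          tendsto_natCast_atTop_atTop)
      have h2 := hG.asymp_im.comp h1
      have h3 : Tendsto (fun n : ℕ => 1 - ε / ((n : ℝ) + 1 + ε)) atTop (𝓝 1) := by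
        have := (tendsto_const_nhds (x := ε)).div_atTop h1
        simpa using this.const_sub 1
      have h4 := h2.mul h3
      rw [mul_one] at h4
      have h5 := (ENNReal.continuous_ofReal.tendsto _).comp h4
      rw [ENNReal.ofReal_one] at h5
      refine h5.congr fun n => ?_
      simp only [Function.comp]
      congr 1
      have : ((n : ℝ) + 1 + ε) ≠ 0 := by positivity
      field_simp
      ring
    · intro n
      refine (Continuous.measurable ?_).aemeasurable
      refine ENNReal.continuous_ofReal.comp (Continuous.mul ?_ hpc)
      refine Continuous.div (by fun_prop) (by fun_prop) fun t => by positivity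
    · refine Eventually.of_forall fun t n m hnm => ?_
      refine ENNReal.ofReal_le_ofReal (mul_le_mul_of_nonneg_right ?_ (hp0 t))
      have : (n : ℝ) ≤ m := by exact_mod_cast hnm
      rw [div_le_div_iff₀ (by positivity) (by positivity)]
      have h6 : ((n : ℝ) + 1) ^ 2 ≤ ((m : ℝ) + 1) ^ 2 := by gcongr
      nlinarith [mul_le_mul_of_nonneg_right h6 (sq_nonneg t)]
    · refine Eventually.of_forall fun t => ?_
      refine (ENNReal.continuous_ofReal.tendsto _).comp ?_
      have h1 : Tendsto (fun n : ℕ => ((n : ℝ) + 1) ^ 2 + t ^ 2) atTop atTop :=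
        tendsto_atTop_add_const_right _ _ ((tendsto_pow_atTop two_ne_zero).comp
          (tendsto_atTop_add_const_right _ _ tendsto_natCast_atTop_atTop))
      have h2 := (tendsto_const_nhds (x := t ^ 2)).div_atTop h1
      have h3 := (h2.const_sub 1).mul_const (p t)
      rw [sub_zero, one_mul] at h3
      refine h3.congr fun n => ?_
      congr 1
      have : ((n : ℝ) + 1) ^ 2 + t ^ 2 ≠ 0 := by positivity
      field_simp
      ring
  set ν : Measure ℝ := volume.withDensity fun t => ENNReal.ofReal (p t) with hν
  have hprob : IsProbabilityMeasure ν := ⟨by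
    rw [hν, withDensity_apply _ MeasurableSet.univ, Measure.restrict_univ, hmass]⟩
  refine ⟨⟨ν, hprob⟩, fun z hz => ?_⟩
  obtain ⟨h1, h2⟩ := hG.poisson_im hε hz
  change ∫ t : ℝ, ‖(z - (t : ℂ))⁻¹‖ ^ 2 ∂ν = _
  rw [hν, integral_withDensity_eq_integral_toReal_smul (by fun_prop)
    (Eventually.of_forall fun t => ENNReal.ofReal_lt_top), ← h2]
  congr 1
  ext t
  rw [ENNReal.toReal_ofReal (hp0 t), smul_eq_mul, mul_comm]

lemma CauchyLike.tight (hG : CauchyLike G) (ν : ℕ → ProbabilityMeasure ℝ)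
    (hν : ∀ (n : ℕ) (z : ℂ), 0 < z.im →
      ∫ t : ℝ, ‖(z - (t : ℂ))⁻¹‖ ^ 2 ∂(ν n : Measure ℝ)
        = -(G (z + ((1 / ((n : ℝ) + 1) : ℝ) : ℂ) * I)).im / z.im) :
    IsTightMeasureSet {((μ : ProbabilityMeasure ℝ) : Measure ℝ) | μ ∈ range ν} := by
  rw [isTightMeasureSet_iff_exists_isCompact_measure_compl_le]
  intro ε hε
  obtain ⟨δ, hδ0, hδ⟩ : ∃ δ : ℝ, 0 < δ ∧ ENNReal.ofReal (4 * δ) ≤ ε := by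
    by_cases ht : ε = ⊤
    · exact ⟨1, one_pos, by rw [ht]; exact le_top⟩
    · have := ENNReal.toReal_pos hε.ne' ht
      refine ⟨ε.toReal / 4, by positivity, ?_⟩
      rw [mul_div_cancel₀ _ (by norm_num), ENNReal.ofReal_toReal ht]
  have h1 := hG.asymp_im.eventually (lt_mem_nhds (by linarith : 1 - δ < 1))
  obtain ⟨y0, hy0⟩ := eventually_atTop.1 h1
  obtain ⟨y, hyy0, hy1, hyδ⟩ : ∃ y : ℝ, y0 ≤ y ∧ 1 ≤ y ∧ 1 / δ ≤ y :=
    ⟨max y0 (max 1 (1 / δ)), le_max_left _ _, (le_max_left _ _).trans (le_max_right _ _),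
      (le_max_right _ _).trans (le_max_right _ _)⟩
  have hy : 0 < y := by linarith
  have hz : 0 < ((y : ℂ) * I).im := by simpa using hy
  refine ⟨Icc (-y) y, isCompact_Icc, ?_⟩
  rintro _ ⟨_, ⟨n, rfl⟩, rfl⟩
  set m : Measure ℝ := (ν n : Measure ℝ) with hm
  set e : ℝ := 1 / ((n : ℝ) + 1) with he
  have he0 : 0 < e := by positivity
  have he1 : e ≤ 1 := by
    rw [he, div_le_one (by positivity)]
    have : (0 : ℝ) ≤ n := Nat.cast_nonneg n
    linarith
  have hval := hν n _ hz
  have e2 : (y : ℂ) * I + (e : ℂ) * I = ((y + e : ℝ) : ℂ) * I := by push_cast; ring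
  have e3 : ((y : ℂ) * I).im = y := by simp
  rw [e2, e3] at hval
  have hs := hy0 (y + e) (by linarith)
  set g := -(G (((y + e : ℝ) : ℂ) * I)).im with hg
  have hs' : 1 - δ < (y + e) * g := by rw [hg]; linarith
  have hint : ∫ t : ℝ, (1 - y ^ 2 * ‖((y : ℂ) * I - (t : ℂ))⁻¹‖ ^ 2) ∂m = 1 - y * g := by
    rw [integral_sub (integrable_const _) ((integrable_sq m hz).const_mul _), integral_const_mul,
      hval]
    simp
    field_simp
  have hfun : ∀ t : ℝ, 1 - y ^ 2 * ‖((y : ℂ) * I - (t : ℂ))⁻¹‖ ^ 2 = t ^ 2 / (y ^ 2 + t ^ 2) := by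
    intro t
    rw [norm_sq_inv hz]
    simp
    field_simp
    ring
  have hmk := mul_meas_ge_le_integral_of_nonneg (μ := m)
    (f := fun t : ℝ => 1 - y ^ 2 * ‖((y : ℂ) * I - (t : ℂ))⁻¹‖ ^ 2)
    (Eventually.of_forall fun t => by
      change 0 ≤ 1 - y ^ 2 * ‖((y : ℂ) * I - (t : ℂ))⁻¹‖ ^ 2
      rw [hfun]; positivity)
    ((integrable_const _).sub ((integrable_sq m hz).const_mul _)) (1 / 2)
  rw [hint] at hmk
  have hsub : (Icc (-y) y)ᶜ ⊆ {t : ℝ | 1 / 2 ≤ 1 - y ^ 2 * ‖((y : ℂ) * I - (t : ℂ))⁻¹‖ ^ 2} := by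
    intro t ht
    change 1 / 2 ≤ 1 - y ^ 2 * ‖((y : ℂ) * I - (t : ℂ))⁻¹‖ ^ 2
    rw [hfun, div_le_div_iff₀ (by norm_num) (by positivity)]
    have : y ^ 2 ≤ t ^ 2 := by
      rw [sq_le_sq, abs_of_pos hy]
      by_contra hlt
      push Not at hlt
      exact ht ⟨(abs_lt.1 hlt).1.le, (abs_lt.1 hlt).2.le⟩
    linarith
  have hle : m.real (Icc (-y) y)ᶜ ≤ 4 * δ := by
    have h3 := measureReal_mono (μ := m) hsub
    have hg0 : g ≤ (y + e)⁻¹ := by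
      have hb := hG.bdd (((y + e : ℝ) : ℂ) * I) (by simp; linarith)
      have e4 : (((y + e : ℝ) : ℂ) * I).im = y + e := by simp
      rw [e4] at hb
      have := Complex.abs_im_le_norm (G (((y + e : ℝ) : ℂ) * I))
      have := neg_le_abs (G (((y + e : ℝ) : ℂ) * I)).im
      linarith
    have hge : e * g ≤ δ := by
      have h4 : (y + e)⁻¹ ≤ δ := by
        rw [inv_le_comm₀ (by linarith) hδ0, ← one_div]; linarith
      have h5 : 0 ≤ g := by
        have := hG.nonpos (((y + e : ℝ) : ℂ) * I) (by simp; linarith)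
        linarith
      nlinarith
    linarith
  have : m (Icc (-y) y)ᶜ = ENNReal.ofReal (m.real (Icc (-y) y)ᶜ) := by
    rw [ofReal_measureReal]
  rw [this]
  exact (ENNReal.ofReal_le_ofReal hle).trans hδ

lemma CauchyLike.exists_measure (hG : CauchyLike G) :
    ∃ ν : Measure ℝ, IsProbabilityMeasure ν ∧ ∀ z : ℂ, 0 < z.im → G z = cauchy ν z := by
  have hpos : ∀ n : ℕ, 0 < (1 / ((n : ℝ) + 1) : ℝ) := fun n => by positivity
  choose ν hν using fun n : ℕ => hG.approx (hpos n)
  have hcomp := isCompact_closure_of_isTightMeasureSet (hG.tight ν hν)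
  obtain ⟨m, -, φ, hφ, hlim⟩ := hcomp.tendsto_subseq (x := ν)
    (fun n => subset_closure (mem_range_self n))
  rw [ProbabilityMeasure.tendsto_iff_forall_integral_tendsto] at hlim
  refine ⟨m, inferInstance, ?_⟩
  have him : ∀ z : ℂ, 0 < z.im → (G z).im = (cauchy (m : Measure ℝ) z).im := by
    intro z hz
    have hb : ∀ t : ℝ, ‖‖(z - (t : ℂ))⁻¹‖ ^ 2‖ ≤ (z.im)⁻¹ ^ 2 := fun t => by
      rw [norm_pow, norm_norm]
      exact pow_le_pow_left₀ (norm_nonneg _) (norm_inv_sub_le hz t) 2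
    have h1 := hlim (BoundedContinuousFunction.ofNormedAddCommGroup
      (fun t : ℝ => ‖(z - (t : ℂ))⁻¹‖ ^ 2) ((continuous_inv_sub hz).norm.pow 2) _ hb)
    simp only [BoundedContinuousFunction.coe_ofNormedAddCommGroup, Function.comp] at h1
    simp_rw [hν _ z hz] at h1
    have h2 : Tendsto (fun n : ℕ => -(G (z + ((1 / ((φ n : ℝ) + 1) : ℝ) : ℂ) * I)).im / z.im) atTop
        (𝓝 (-(G z).im / z.im)) := by
      have h3 : Tendsto (fun n : ℕ => (1 / ((n : ℝ) + 1) : ℝ)) atTop (𝓝 0) :=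
        tendsto_one_div_add_atTop_nhds_zero_nat
      have h4 : Tendsto (fun n : ℕ => z + ((1 / ((φ n : ℝ) + 1) : ℝ) : ℂ) * I) atTop (𝓝 z) := by
        have h5 := (((Complex.continuous_ofReal.tendsto 0).comp
          (h3.comp hφ.tendsto_atTop)).mul_const I).const_add z
        simpa [Function.comp_def] using h5
      have h6 := (hG.diff z hz).continuousAt.tendsto.comp h4
      exact (((Complex.continuous_im.tendsto _).comp h6).neg).div_const _
    have h7 := tendsto_nhds_unique h1 h2
    rw [cauchy_im _ hz, h7]
    field_simp
  set U : Set ℂ := {z | 0 < z.im} with hU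
  have hUo : IsOpen U := isOpen_lt continuous_const Complex.continuous_im
  have hUc : IsConnected U := by
    refine (convex_halfSpace_im_gt 0).isPathConnected ⟨I, by simp [hU]⟩ |>.isConnected
  have hd : DifferentiableOn ℂ (fun z => G z - cauchy (m : Measure ℝ) z) U := fun z hz =>
    ((hG.diff z hz).sub (cauchy_differentiableAt _ hz)).differentiableWithinAt
  obtain ⟨c, hc⟩ := (hd.analyticOnNhd hUo).eq_const_of_im_eq_const (c₀ := 0)
    (fun z hz => by rw [Complex.sub_im, him z hz, sub_self]) hUo hUc
  have hc0 : c = 0 := by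
    have h1 : ∀ᶠ y : ℝ in atTop, ‖c‖ ≤ 2 * y⁻¹ := by
      filter_upwards [eventually_gt_atTop 0] with y hy
      have hz : 0 < ((y : ℂ) * I).im := by simpa using hy
      rw [← hc _ hz]
      have b1 := hG.bdd _ hz
      have b2 := norm_cauchy_le (m : Measure ℝ) hz
      have e3 : ((y : ℂ) * I).im = y := by simp
      rw [e3] at b1 b2
      have := norm_sub_le (G ((y : ℂ) * I)) (cauchy (m : Measure ℝ) ((y : ℂ) * I))
      linarith
    have h2 : Tendsto (fun y : ℝ => 2 * y⁻¹) atTop (𝓝 0) := by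
      simpa using tendsto_inv_atTop_zero.const_mul (2 : ℝ)
    exact norm_le_zero_iff.1 (ge_of_tendsto h2 h1)
  intro z hz
  have := hc z hz
  rw [hc0] at this
  exact sub_eq_zero.1 this

end

lemma inv_asymp_of {f : ℝ → ℂ}
    (h : Tendsto (fun y : ℝ => ‖f y - (y : ℂ) * I‖ / y) atTop (𝓝 0)) :
    Tendsto (fun y : ℝ => ((y : ℂ) * I) * (f y)⁻¹) atTop (𝓝 1) := by
  have h1 : Tendsto (fun y : ℝ => f y / ((y : ℂ) * I)) atTop (𝓝 1) := by
    rw [tendsto_iff_norm_sub_tendsto_zero]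
    refine h.congr' ?_
    filter_upwards [eventually_gt_atTop (0 : ℝ)] with y hy
    have hne : (y : ℂ) * I ≠ 0 := mul_ne_zero (by exact_mod_cast hy.ne') I_ne_zero
    have e : f y / ((y : ℂ) * I) - 1 = (f y - (y : ℂ) * I) / ((y : ℂ) * I) := by
      rw [sub_div, div_self hne]
    rw [e, norm_div, norm_mul, norm_I, mul_one, Complex.norm_real, Real.norm_of_nonneg hy.le]
  have h2 := h1.inv₀ one_ne_zero
  rw [inv_one] at h2
  refine h2.congr fun y => ?_
  rw [inv_div, div_eq_mul_inv]

theorem stmt_8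
    (μ : Measure ℝ) [IsProbabilityMeasure μ] (n : ℕ) (hn : 1 ≤ n) :
    ∃ Z : ℂ → ℂ, Subord μ n Z ∧
      (∀ Z' : ℂ → ℂ, Subord μ n Z' → ∀ z : ℂ, 0 < z.im → Z' z = Z z) ∧
      ∃ ν : Measure ℝ, IsProbabilityMeasure ν ∧
        ∀ z : ℂ, 0 < z.im → recip ν z = recip μ (Z z) := by
  have hc : (0 : ℝ) ≤ (n : ℝ) - 1 := by
    have : (1 : ℝ) ≤ n := by exact_mod_cast hn
    linarith
  have hk := pickFn_hh μ ((n : ℝ) - 1) hc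
  obtain ⟨Z, hZ, hZa⟩ := hk.main
  have hpos : ∀ z : ℂ, 0 < z.im → 0 < (Z z).im := fun z hz => hz.trans_le (hZ z hz).1
  have hne : ∀ z : ℂ, 0 < z.im → Z z ≠ 0 := by
    intro z hz h
    have := hpos z hz
    rw [h] at this
    simp at this
  have heq : ∀ z : ℂ, 0 < z.im → z = (n : ℂ) * Z z - ((n : ℂ) - 1) * recip μ (Z z) := by
    intro z hz
    have h := (hZ z hz).2.1
    simp only [hh] at h
    push_cast at h
    linear_combination h
  have hF : MemF Z := by
    have hG : CauchyLike (fun z => (Z z)⁻¹) :=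
      { diff := fun z hz => ((hZ z hz).2.2).inv (hne z hz)
        nonpos := fun z hz => by
          show ((Z z)⁻¹).im ≤ 0
          rw [inv_im]
          exact div_nonpos_of_nonpos_of_nonneg (by linarith [hpos z hz]) (normSq_nonneg _)
        bdd := fun z hz => by
          show ‖(Z z)⁻¹‖ ≤ _
          rw [norm_inv]
          exact inv_anti₀ hz (((hZ z hz).1.trans (le_abs_self _)).trans (abs_im_le_norm _))
        asymp := inv_asymp_of hZa }
    obtain ⟨ν, hν, h⟩ := hG.exists_measure
    exact ⟨ν, hν, fun z hz => by rw [recip, ← h z hz, inv_inv]⟩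
  refine ⟨Z, ⟨hF, heq⟩, ?_, ?_⟩
  · rintro Z' ⟨⟨ν', hν', hZ'⟩, he'⟩ z hz
    have hp' : 0 < (Z' z).im := by
      rw [hZ' z hz]
      exact hz.trans_le (im_le_recip ν' hz)
    refine hk.uniq hz hp' (hpos z hz) ?_ (hZ z hz).2.1
    have h := he' z hz
    simp only [hh]
    push_cast
    linear_combination h
  · have hG : CauchyLike (fun z => cauchy μ (Z z)) :=
      { diff := fun z hz =>
          DifferentiableAt.comp (g := cauchy μ) (f := Z) z (cauchy_differentiableAt μ (hpos z hz)) (hZ z hz).2.2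
        nonpos := fun z hz => (cauchy_im_neg μ (hpos z hz)).le
        bdd := fun z hz => (norm_cauchy_le μ (hpos z hz)).trans (inv_anti₀ hz (hZ z hz).1)
        asymp := by
          rcases hc.eq_or_lt with h0 | h0
          · refine (cauchy_asymp μ).congr' ?_
            filter_upwards [eventually_gt_atTop (0 : ℝ)] with y hy
            have hy' : 0 < ((y : ℂ) * I).im := by simpa using hy
            have h := (hZ _ hy').2.1
            rw [← h0] at h
            simp only [ofReal_zero, zero_mul, add_zero] at h
            show _ = (y : ℂ) * I * cauchy μ (Z ((y : ℂ) * I))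
            rw [← h]
          · have key : Tendsto (fun y : ℝ => ‖recip μ (Z ((y : ℂ) * I)) - (y : ℂ) * I‖ / y)
                atTop (𝓝 0) := by
              have h2 := hZa.const_mul (1 + ((n : ℝ) - 1)⁻¹)
              rw [mul_zero] at h2
              refine h2.congr' ?_
              filter_upwards [eventually_gt_atTop (0 : ℝ)] with y hy
              have hy' : 0 < ((y : ℂ) * I).im := by simpa using hy
              have h := (hZ _ hy').2.1
              simp only [hh] at h
              have hcn : (((n : ℝ) - 1 : ℝ) : ℂ) ≠ 0 := by exact_mod_cast h0.ne'
              have e : recip μ (Z ((y : ℂ) * I)) - (y : ℂ) * I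
                  = ((1 + ((n : ℝ) - 1)⁻¹ : ℝ) : ℂ) * (Z ((y : ℂ) * I) - (y : ℂ) * I) := by
                generalize (n : ℝ) - 1 = c at *
                push_cast
                field_simp
                linear_combination h
              rw [e, norm_mul, Complex.norm_real, Real.norm_of_nonneg (by positivity), mul_div_assoc]
            refine (inv_asymp_of key).congr fun y => ?_
            rw [recip, inv_inv] }
    obtain ⟨ν, hν, h⟩ := hG.exists_measure
    exact ⟨ν, hν, fun z hz => by rw [recip, recip, ← h z hz]⟩

end FreeCLT
end
end

section
/- Let μ be a Borel probability measure on ℝ and n ≥ 1 an integer, and let Z ∈ 𝓕 be the unique solution of z = nZ(z) − (n−1)F_μ(Z(z)) on ℂ⁺. Write F_μ(z) = z + Re F_μ(i) + ∫_ℝ (1+uz)/(u−z) τ(du) with a finite nonnegative Borel measure τ, set I_μ(x,y) = ∫_ℝ (1+u²) / ((u−x)² + y²) τ(du) for x ∈ ℝ, y > 0, and for each x ∈ ℝ let y_n(x) be the unique y > 0 with (n−1) I_μ(x,y) = 1 if such y exists, and y_n(x) = 0 otherwise (which happens exactly when lim_{y↓0} I_μ(x,y) ≤ 1/(n−1)).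 Then Z maps ℂ⁺ conformally (i.e. analytically and bijectively) onto the open domain D̃_n = {x + iy : x, y ∈ ℝ, y > y_n(x)}; furthermore Z extends continuously to ℂ⁺ ∪ ℝ and this extension restricted to ℝ is a homeomorphism from ℝ onto the curve γ_n = {x + i y_n(x) : x ∈ ℝ}. -/
open MeasureTheory Complex Filter Set
open scoped Topology

noncomputable section

namespace FreeCLT

lemma nsq (u : ℝ) (w : ℂ) : ‖(u:ℂ) - w‖^2 = (u - w.re)^2 + w.im^2 := by
  rw [Complex.sq_norm, Complex.normSq_apply]; simp; ring

lemma im_le_norm_sub_s9 (u : ℝ) (w : ℂ) : w.im ≤ ‖(u:ℂ) - w‖ := by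
  have := Complex.abs_im_le_norm ((u:ℂ) - w)
  simp at this
  exact (le_abs_self _).trans this

lemma sub_ne (u : ℝ) {w : ℂ} (hw : 0 < w.im) : (u:ℂ) - w ≠ 0 := by
  intro h
  have := im_le_norm_sub_s9 u w
  rw [h] at this; simp at this; linarith

lemma den_pos (u : ℝ) {w : ℂ} (hw : 0 < w.im) : 0 < (u - w.re)^2 + w.im^2 := by positivity

lemma cauchy_integrable (τ : Measure ℝ) [IsFiniteMeasure τ] {w : ℂ} (hw : 0 < w.im) :
    Integrable (fun u : ℝ => (w - (u:ℂ))⁻¹) τ := by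
  refine Integrable.of_bound (C := 1 / w.im) ?_ ?_
  · apply Measurable.aestronglyMeasurable; fun_prop
  · refine Eventually.of_forall fun u => ?_
    rw [norm_inv, norm_sub_rev, ← one_div]
    exact one_div_le_one_div_of_le hw (im_le_norm_sub_s9 u w)

lemma cauchy_diff (τ : Measure ℝ) [IsFiniteMeasure τ] {w : ℂ} (hw : 0 < w.im) :
    DifferentiableAt ℂ (cauchy τ) w := by
  have hs : {z : ℂ | w.im / 2 < z.im} ∈ 𝓝 w :=
    (isOpen_lt continuous_const Complex.continuous_im).mem_nhds (by simp; linarith)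
  have := hasDerivAt_integral_of_dominated_loc_of_deriv_le (μ := τ) (𝕜 := ℂ)
    (F := fun z (u:ℝ) => (z - (u:ℂ))⁻¹) (F' := fun z (u:ℝ) => -1 / (z - (u:ℂ))^2) (x₀ := w)
    (bound := fun _ => 1 / (w.im/2)^2) hs ?_ (cauchy_integrable τ hw) ?_ ?_ ?_ ?_
  · exact this.2.differentiableAt
  · exact Eventually.of_forall fun z => by apply Measurable.aestronglyMeasurable; fun_prop
  · apply Measurable.aestronglyMeasurable; fun_prop
  · refine Eventually.of_forall fun u z hz => ?_
    simp only [mem_ofPred_eq] at hz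
    rw [norm_div, norm_pow, norm_sub_rev, norm_neg, norm_one]
    have := im_le_norm_sub_s9 u z
    have h2 : 0 < w.im / 2 := by linarith
    gcongr
    linarith
  · exact integrable_const _
  · refine Eventually.of_forall fun u z hz => ?_
    simp only [mem_ofPred_eq] at hz
    have h0 : z - (u:ℂ) ≠ 0 := by
      rw [← neg_sub, neg_ne_zero]; exact sub_ne u (by linarith)
    exact ((hasDerivAt_id z).sub_const (u:ℂ)).fun_inv h0

lemma int_pos (τ : Measure ℝ) [IsFiniteMeasure τ] (hτ : τ ≠ 0) (f : ℝ → ℝ) (hf : Integrable f τ)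
    (h : ∀ u, 0 < f u) : 0 < ∫ u, f u ∂τ := by
  rw [integral_pos_iff_support_of_nonneg (fun u => (h u).le) hf]
  have : Function.support f = univ := by
    ext u; have := h u; simp only [Function.mem_support, mem_univ, iff_true]; exact this.ne'
  rw [this]; simpa [pos_iff_ne_zero] using hτ

lemma cauchy_im_s9 (ν : Measure ℝ) [IsProbabilityMeasure ν] {w : ℂ} (hw : 0 < w.im) :
    (cauchy ν w).im < 0 := by
  have h1 : (cauchy ν w).im = ∫ u, ((w - (u:ℂ))⁻¹).im ∂ν := by
    have := Complex.imCLM.integral_comp_comm (cauchy_integrable ν hw)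
    simp only [Complex.imCLM_apply] at this
    exact this.symm
  have hp : ∀ u : ℝ, ((w - (u:ℂ))⁻¹).im < 0 := fun u => by
    have := den_pos u hw
    rw [Complex.inv_im]
    apply div_neg_of_neg_of_pos
    · simpa using hw
    · rw [Complex.normSq_pos, ← neg_sub, neg_ne_zero]; exact sub_ne u hw
  have hi : Integrable (fun u : ℝ => ((w - (u:ℂ))⁻¹).im) ν := (cauchy_integrable ν hw).im
  have h2 : 0 < ∫ u, -((w - (u:ℂ))⁻¹).im ∂ν :=
    int_pos ν (IsProbabilityMeasure.ne_zero ν) _ hi.neg (fun u => by have := hp u; linarith)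
  rw [integral_neg] at h2
  linarith

lemma cauchy_ne_s9 (ν : Measure ℝ) [IsProbabilityMeasure ν] {w : ℂ} (hw : 0 < w.im) :
    cauchy ν w ≠ 0 := fun h => by
  have := cauchy_im_s9 ν hw; rw [h] at this; simp at this

lemma recip_im (ν : Measure ℝ) [IsProbabilityMeasure ν] {w : ℂ} (hw : 0 < w.im) :
    0 < ((cauchy ν w)⁻¹).im := by
  rw [Complex.inv_im]
  exact div_pos (by have := cauchy_im_s9 ν hw; linarith) (Complex.normSq_pos.2 (cauchy_ne_s9 ν hw))

def I0 (τ : Measure ℝ) (w : ℂ) : ℝ := ∫ u, (1 + u ^ 2) / ((u - w.re) ^ 2 + w.im ^ 2) ∂τ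
def K (τ : Measure ℝ) (w : ℂ) : ℂ := ∫ u, (1 + (u : ℂ) * w) / ((u : ℂ) - w) ∂τ
def Q (τ : Measure ℝ) (w v : ℂ) : ℂ := ∫ u, (1 + (u : ℂ)^2) / (((u : ℂ) - w) * ((u:ℂ) - v)) ∂τ

lemma I0_int (τ : Measure ℝ) [IsFiniteMeasure τ] {w : ℂ} (hw : 0 < w.im) :
    Integrable (fun u : ℝ => (1 + u ^ 2) / ((u - w.re) ^ 2 + w.im ^ 2)) τ := by
  refine Integrable.of_bound (C := 2 + (1 + 2 * w.re^2) / w.im^2) ?_ ?_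
  · apply Measurable.aestronglyMeasurable; fun_prop
  · refine Eventually.of_forall fun u => ?_
    have hd := den_pos u hw
    rw [Real.norm_of_nonneg (by positivity), div_le_iff₀ hd]
    have h1 : (1 + 2 * w.re^2) / w.im^2 * w.im^2 = 1 + 2 * w.re^2 := by field_simp
    have h2 : 0 ≤ (1 + 2 * w.re^2) / w.im^2 := by positivity
    have h3 := mul_nonneg h2 (sq_nonneg (u - w.re))
    nlinarith [sq_nonneg (u - 2*w.re), sq_nonneg w.im]

lemma Kpt (u : ℝ) {w : ℂ} (hw : 0 < w.im) :
    (1 + (u : ℂ) * w) / ((u : ℂ) - w) = w - (1 + w^2) * (w - (u:ℂ))⁻¹ := by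
  have h1 := sub_ne u hw
  have h2 : w - (u:ℂ) ≠ 0 := by rw [← neg_sub, neg_ne_zero]; exact h1
  field_simp
  ring

lemma K_int (τ : Measure ℝ) [IsFiniteMeasure τ] {w : ℂ} (hw : 0 < w.im) :
    Integrable (fun u : ℝ => (1 + (u : ℂ) * w) / ((u : ℂ) - w)) τ := by
  simp_rw [Kpt _ hw]
  exact (integrable_const _).sub ((cauchy_integrable τ hw).const_mul _)

lemma K_eq (τ : Measure ℝ) [IsFiniteMeasure τ] {w : ℂ} (hw : 0 < w.im) :
    K τ w = (τ.real univ : ℂ) * w - (1 + w^2) * cauchy τ w := by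
  unfold K cauchy
  simp_rw [Kpt _ hw]
  rw [integral_sub (integrable_const _) ((cauchy_integrable τ hw).const_mul _),
    integral_const_mul, integral_const]
  simp

lemma K_cont (τ : Measure ℝ) [IsFiniteMeasure τ] {w : ℂ} (hw : 0 < w.im) :
    ContinuousAt (K τ) w := by
  have : (fun w => (τ.real univ : ℂ) * w - (1 + w^2) * cauchy τ w) =ᶠ[𝓝 w] K τ := by
    filter_upwards [(isOpen_lt continuous_const Complex.continuous_im).mem_nhds hw] with z hz
    exact (K_eq τ hz).symm
  refine ContinuousAt.congr ?_ this
  have := (cauchy_diff τ hw).continuousAt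
  fun_prop

lemma K_im (τ : Measure ℝ) [IsFiniteMeasure τ] {w : ℂ} (hw : 0 < w.im) :
    (K τ w).im = w.im * I0 τ w := by
  have := Complex.imCLM.integral_comp_comm (K_int τ hw)
  simp only [Complex.imCLM_apply] at this
  rw [K, ← this, I0, ← integral_const_mul]
  congr 1; ext u
  have hd := den_pos u hw
  have : Complex.normSq ((u:ℂ) - w) = (u - w.re)^2 + w.im^2 := by
    rw [← Complex.sq_norm, nsq]
  rw [Complex.div_im, this]
  simp
  field_simp
  ring

lemma Qpt_norm (u : ℝ) {w v : ℂ} (hw : 0 < w.im) (hv : 0 < v.im) :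
    ‖(1 + (u : ℂ)^2) / (((u : ℂ) - w) * ((u:ℂ) - v))‖ ≤
     ((1 + u ^ 2) / ((u - w.re) ^ 2 + w.im ^ 2) + (1 + u ^ 2) / ((u - v.re) ^ 2 + v.im ^ 2)) / 2 := by
  rw [← nsq, ← nsq, norm_div, norm_mul]
  have h0 : ‖(1 + (u : ℂ)^2)‖ = 1 + u^2 := by
    rw [← ofReal_pow, ← ofReal_one, ← ofReal_add, Complex.norm_real, Real.norm_of_nonneg (by positivity)]
  rw [h0]
  have h1 : 0 < ‖(u:ℂ) - w‖ := norm_pos_iff.2 (sub_ne u hw)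
  have h2 : 0 < ‖(u:ℂ) - v‖ := norm_pos_iff.2 (sub_ne u hv)
  set a := ‖(u:ℂ) - w‖
  set b := ‖(u:ℂ) - v‖
  have : ((1 + u ^ 2) / a^2 + (1 + u ^ 2) / b^2) / 2 - (1+u^2)/(a*b) = (1+u^2)/2 * (1/a - 1/b)^2 := by
    field_simp; ring
  have h3 : 0 ≤ (1+u^2)/2 * (1/a - 1/b)^2 := by positivity
  linarith

lemma Q_int (τ : Measure ℝ) [IsFiniteMeasure τ] {w v : ℂ} (hw : 0 < w.im) (hv : 0 < v.im) :
    Integrable (fun u : ℝ => (1 + (u : ℂ)^2) / (((u : ℂ) - w) * ((u:ℂ) - v))) τ := by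
  refine Integrable.mono' (((I0_int τ hw).add (I0_int τ hv)).div_const 2) ?_ ?_
  · apply Measurable.aestronglyMeasurable; fun_prop
  · exact Eventually.of_forall fun u => Qpt_norm u hw hv

lemma Q_norm (τ : Measure ℝ) [IsFiniteMeasure τ] {w v : ℂ} (hw : 0 < w.im) (hv : 0 < v.im) :
    ‖Q τ w v‖ ≤ (I0 τ w + I0 τ v) / 2 := by
  unfold I0
  rw [← integral_add (I0_int τ hw) (I0_int τ hv), ← integral_div]
  refine norm_integral_le_of_norm_le (((I0_int τ hw).add (I0_int τ hv)).div_const 2) ?_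
  exact Eventually.of_forall fun u => Qpt_norm u hw hv

lemma K_sub (τ : Measure ℝ) [IsFiniteMeasure τ] {w v : ℂ} (hw : 0 < w.im) (hv : 0 < v.im) :
    K τ w - K τ v = (w - v) * Q τ w v := by
  unfold K Q
  rw [← integral_sub (K_int τ hw) (K_int τ hv), ← integral_const_mul]
  congr 1; ext u
  have := sub_ne u hw
  have := sub_ne u hv
  field_simp
  ring

lemma ub (u R : ℝ) (hR : 1 ≤ R) (w : ℂ) (h : ‖w‖ ≤ R) : ‖(u:ℂ) - w‖^2 ≤ 2 * R^2 * (1+u^2) := by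
  have h1 : ‖(u:ℂ) - w‖ ≤ |u| + R := (norm_sub_le _ _).trans (by simp; exact h)
  have h2 := pow_le_pow_left₀ (norm_nonneg _) h1 2
  have h3 : (|u| + R)^2 ≤ 2 * u^2 + 2 * R^2 := by nlinarith [sq_nonneg (|u| - R), sq_abs u]
  nlinarith [sq_nonneg u, mul_le_mul hR hR zero_le_one (by linarith)]

lemma Qpt_re (u R : ℝ) (hR : 1 ≤ R) {w v : ℂ} (hw : 0 < w.im) (hv : 0 < v.im)
    (hwR : ‖w‖ ≤ R) (hvR : ‖v‖ ≤ R) :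
    ((1 + (u : ℂ)^2) / (((u : ℂ) - w) * ((u:ℂ) - v))).re ≤
     ((1 + u ^ 2) / ((u - w.re) ^ 2 + w.im ^ 2) + (1 + u ^ 2) / ((u - v.re) ^ 2 + v.im ^ 2)) / 2
      - ‖w - v‖^2 / (8 * R^4) * (1 / (1 + u^2)) := by
  have hA := den_pos u hw
  have hB := den_pos u hv
  have u1 := ub u R hR w hwR
  have u2 := ub u R hR v hvR
  rw [nsq] at u1 u2
  have e : ((1 + (u : ℂ)^2) / (((u : ℂ) - w) * ((u:ℂ) - v))).re
      = (1 + u^2) * ((u - w.re) * (u - v.re) - w.im * v.im) /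
        (((u - w.re) ^ 2 + w.im ^ 2) * ((u - v.re) ^ 2 + v.im ^ 2)) := by
    have : (1 + (u : ℂ)^2) = ((1 + u^2 : ℝ) : ℂ) := by push_cast; ring
    rw [this, Complex.div_re, Complex.normSq_mul, ← Complex.sq_norm, ← Complex.sq_norm, nsq, nsq,
      Complex.ofReal_re, Complex.ofReal_im]
    simp
  have d : ‖w - v‖^2 = (w.re - v.re)^2 + (w.im - v.im)^2 := by
    rw [Complex.sq_norm, Complex.normSq_apply]; simp; ring
  rw [e, d]
  have key : ((1 + u ^ 2) / ((u - w.re) ^ 2 + w.im ^ 2) + (1 + u ^ 2) / ((u - v.re) ^ 2 + v.im ^ 2)) / 2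
    - (1 + u^2) * ((u - w.re) * (u - v.re) - w.im * v.im) /
        (((u - w.re) ^ 2 + w.im ^ 2) * ((u - v.re) ^ 2 + v.im ^ 2))
    = (1+u^2) * ((w.re - v.re)^2 + (w.im + v.im)^2) / 2 / 
        (((u - w.re) ^ 2 + w.im ^ 2) * ((u - v.re) ^ 2 + v.im ^ 2)) := by
    field_simp; ring
  have key2 : ((w.re - v.re)^2 + (w.im - v.im)^2) / (8 * R^4) * (1 / (1 + u^2)) ≤ 
     (1+u^2) * ((w.re - v.re)^2 + (w.im + v.im)^2) / 2 / 
        (((u - w.re) ^ 2 + w.im ^ 2) * ((u - v.re) ^ 2 + v.im ^ 2)) := by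
    calc _ ≤ ((w.re - v.re)^2 + (w.im + v.im)^2) / (8 * R^4) * (1 / (1 + u^2)) := by
          gcongr ?_ / _ * _
          nlinarith [mul_pos hw hv]
      _ = (1+u^2) * ((w.re - v.re)^2 + (w.im + v.im)^2) / 2 / 
        ((2 * R^2 * (1+u^2)) * (2 * R^2 * (1+u^2))) := by
          have : R ≠ 0 := by linarith
          field_simp; ring
      _ ≤ _ := by gcongr
  linarith

lemma c_int (τ : Measure ℝ) [IsFiniteMeasure τ] : Integrable (fun u : ℝ => 1 / (1 + u^2)) τ := by
  refine Integrable.of_bound (C := 1) ?_ ?_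
  · apply Measurable.aestronglyMeasurable; fun_prop
  · refine Eventually.of_forall fun u => ?_
    rw [Real.norm_of_nonneg (by positivity), div_le_one (by positivity)]
    nlinarith [sq_nonneg u]

lemma Q_re (τ : Measure ℝ) [IsFiniteMeasure τ] (R : ℝ) (hR : 1 ≤ R) {w v : ℂ} (hw : 0 < w.im)
    (hv : 0 < v.im) (hwR : ‖w‖ ≤ R) (hvR : ‖v‖ ≤ R) :
    (Q τ w v).re ≤ (I0 τ w + I0 τ v) / 2 - ‖w - v‖^2 / (8 * R^4) * ∫ u, 1 / (1 + u^2) ∂τ := by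
  have := Complex.reCLM.integral_comp_comm (Q_int τ hw hv)
  simp only [Complex.reCLM_apply] at this
  have hi : Integrable (fun u : ℝ => ((1 + u ^ 2) / ((u - w.re) ^ 2 + w.im ^ 2)
      + (1 + u ^ 2) / ((u - v.re) ^ 2 + v.im ^ 2)) / 2) τ :=
    ((I0_int τ hw).add (I0_int τ hv)).div_const 2
  rw [Q, ← this]
  unfold I0
  rw [← integral_add (I0_int τ hw) (I0_int τ hv), ← integral_div, ← integral_const_mul,
    ← integral_sub hi ((c_int τ).const_mul _)]
  refine integral_mono (Q_int τ hw hv).re (hi.sub ((c_int τ).const_mul _)) ?_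
  exact fun u => Qpt_re u R hR hw hv hwR hvR

lemma I0_strict (τ : Measure ℝ) [IsFiniteMeasure τ] (hτ : τ ≠ 0) {w v : ℂ} (hw : 0 < w.im)
    (hre : w.re = v.re) (h : w.im < v.im) : I0 τ v < I0 τ w := by
  have hv := hw.trans h
  have hs := (I0_int τ hw).sub (I0_int τ hv)
  have := int_pos τ hτ _ hs (fun u => by
    have := den_pos u hw
    have := den_pos u hv
    simp only [Pi.sub_apply, sub_pos, hre] at *
    gcongr)
  simp only [Pi.sub_apply] at this
  rw [integral_sub (I0_int τ hw) (I0_int τ hv)] at this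
  unfold I0; linarith

lemma I0_cont (τ : Measure ℝ) [IsFiniteMeasure τ] {w : ℂ} (hw : 0 < w.im) :
    ContinuousAt (I0 τ) w := by
  have : (fun w => (K τ w).im / w.im) =ᶠ[𝓝 w] I0 τ := by
    filter_upwards [(isOpen_lt continuous_const Complex.continuous_im).mem_nhds hw] with z hz
    rw [K_im τ hz]; have : z.im ≠ 0 := ne_of_gt hz
    field_simp
  refine ContinuousAt.congr ?_ this
  exact (Complex.continuous_im.continuousAt.comp (K_cont τ hw)).div Complex.continuous_im.continuousAt hw.ne'

lemma I0_lim (τ : Measure ℝ) [IsFiniteMeasure τ] (x : ℝ) :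
    Tendsto (fun y : ℝ => I0 τ ⟨x, y⟩) atTop (𝓝 0) := by
  have h1 : (0:ℝ) < (⟨x, 1⟩ : ℂ).im := by simp
  have := tendsto_integral_filter_of_dominated_convergence (μ := τ) (l := (atTop : Filter ℝ))
    (F := fun y u => (1 + u ^ 2) / ((u - x) ^ 2 + y ^ 2)) (f := fun _ => (0:ℝ)) _ ?_ ?_ (I0_int τ h1) ?_
  · simpa [I0] using this
  · exact Eventually.of_forall fun y => by apply Measurable.aestronglyMeasurable; fun_prop
  · filter_upwards [eventually_ge_atTop 1] with y hy
    refine Eventually.of_forall fun u => ?_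
    have : 0 < (u - x)^2 + y^2 := by positivity
    rw [Real.norm_of_nonneg (by positivity)]
    gcongr
  · refine Eventually.of_forall fun u => ?_
    apply Tendsto.const_div_atTop
    exact tendsto_atTop_add_const_left _ _ (tendsto_pow_atTop (by norm_num))

lemma I0_nonneg (τ : Measure ℝ) (w : ℂ) : 0 ≤ I0 τ w := integral_nonneg fun u => by positivity

def H (τ : Measure ℝ) (m a : ℝ) (w : ℂ) : ℂ := w - m * (a + K τ w)

section
variable (τ : Measure ℝ) [IsFiniteMeasure τ] (m a : ℝ)

lemma H_im {w : ℂ} (hw : 0 < w.im) : (H τ m a w).im = w.im * (1 - m * I0 τ w) := by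
  simp [H, K_im τ hw]; ring

lemma H_sub {w v : ℂ} (hw : 0 < w.im) (hv : 0 < v.im) :
    H τ m a w - H τ m a v = (w - v) * (1 - m * Q τ w v) := by
  have := K_sub τ hw hv
  unfold H
  linear_combination (-(m:ℂ)) * this

lemma H_cont {w : ℂ} (hw : 0 < w.im) : ContinuousAt (H τ m a) w := by
  have := K_cont τ hw
  unfold H
  fun_prop

lemma mQ_norm (hm : 0 ≤ m) {w v : ℂ} (hw : 0 < w.im) (hv : 0 < v.im) :
    ‖(m:ℂ) * Q τ w v‖ ≤ (m * I0 τ w + m * I0 τ v) / 2 := by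
  rw [norm_mul, Complex.norm_real, Real.norm_of_nonneg hm]
  have := mul_le_mul_of_nonneg_left (Q_norm τ hw hv) hm
  linarith

lemma H_lip (hm : 0 ≤ m) {w v : ℂ} (hw : 0 < w.im) (hv : 0 < v.im)
    (h1 : m * I0 τ w ≤ 1) (h2 : m * I0 τ v ≤ 1) :
    ‖H τ m a w - H τ m a v‖ ≤ 2 * ‖w - v‖ := by
  rw [H_sub τ m a hw hv, norm_mul, mul_comm]
  gcongr
  have h3 := mQ_norm τ m hm hw hv
  have := norm_sub_le (1:ℂ) (m * Q τ w v)
  rw [norm_one] at this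
  linarith

lemma H_far (hm : 0 ≤ m) {w v : ℂ} (hw : 0 < w.im) (hv : 0 < v.im) :
    ‖w - v‖ * (1 - (m * I0 τ w + m * I0 τ v) / 2) ≤ ‖H τ m a w - H τ m a v‖ := by
  rw [H_sub τ m a hw hv, norm_mul]
  gcongr
  have h3 := mQ_norm τ m hm hw hv
  have := norm_sub_norm_le (1:ℂ) (m * Q τ w v)
  rw [norm_one] at this
  linarith

lemma H_cubic (hm : 0 ≤ m) (R : ℝ) (hR : 1 ≤ R) : ∃ C : ℝ, 0 < C ∧ ∀ w v : ℂ, 0 < w.im → 0 < v.im →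
    m * I0 τ w ≤ 1 → m * I0 τ v ≤ 1 → ‖w‖ ≤ R → ‖v‖ ≤ R →
    ‖w - v‖^3 ≤ C * ‖H τ m a w - H τ m a v‖ := by
  by_cases h0 : m = 0 ∨ τ = 0
  · refine ⟨4 * R^2, by positivity, fun w v hw hv h1 h2 hwR hvR => ?_⟩
    have e : ∀ z, m * I0 τ z = 0 := by
      intro z; rcases h0 with rfl | rfl <;> simp [I0]
    have := H_far τ m a hm hw hv
    rw [e, e] at this
    have h4 : ‖w - v‖ ≤ 2 * R := (norm_sub_le _ _).trans (by linarith)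
    have h5 := pow_le_pow_left₀ (norm_nonneg _) h4 2
    calc ‖w - v‖^3 = ‖w-v‖^2 * ‖w-v‖ := by ring
      _ ≤ (2*R)^2 * ‖H τ m a w - H τ m a v‖ := by gcongr; linarith
      _ = _ := by ring
  · push Not at h0
    obtain ⟨hm0, hτ⟩ := h0
    have hmp : 0 < m := lt_of_le_of_ne hm hm0.symm
    have hc := int_pos τ hτ _ (c_int τ) (fun u => by positivity)
    set c := ∫ u, 1 / (1 + u^2) ∂τ with hcdef
    have hR0 : 0 < R := by linarith
    refine ⟨8 * R^4 / (m * c), by positivity, fun w v hw hv h1 h2 hwR hvR => ?_⟩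
    have h3 := mul_le_mul_of_nonneg_left (Q_re τ R hR hw hv hwR hvR) hm
    rw [← hcdef] at h3
    have h4 : ‖w - v‖^2 / (8 * R^4) * (m * c) ≤ ‖1 - m * Q τ w v‖ := by
      have := Complex.re_le_norm (1 - m * Q τ w v)
      simp at this
      nlinarith
    rw [H_sub τ m a hw hv, norm_mul]
    calc ‖w - v‖^3 = 8 * R^4 / (m*c) * (‖w - v‖ * (‖w - v‖^2 / (8 * R^4) * (m * c))) := by
          field_simp
      _ ≤ _ := by gcongr

lemma yn_char (hm : 0 ≤ m) (yn : ℝ → ℝ)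
    (hyn : ∀ x : ℝ, (0 < yn x ∧ m * I0 τ ⟨x, yn x⟩ = 1)
      ∨ (yn x = 0 ∧ ∀ y : ℝ, 0 < y → m * I0 τ ⟨x, y⟩ ≠ 1)) {w : ℂ} (hw : 0 < w.im) :
    (yn w.re < w.im ↔ m * I0 τ w < 1) ∧ (m * I0 τ w ≤ 1 → yn w.re ≤ w.im) := by
  rcases hyn w.re with ⟨h1, h2⟩ | ⟨h1, h2⟩
  · have hmp : 0 < m := lt_of_le_of_ne hm (by rintro rfl; simp at h2)
    have hτ : τ ≠ 0 := by rintro rfl; simp [I0] at h2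
    have A : yn w.re < w.im → m * I0 τ w < 1 := fun h => by
      rw [← h2]
      exact mul_lt_mul_of_pos_left (I0_strict τ hτ (w := ⟨w.re, yn w.re⟩) h1 rfl h) hmp
    have B : w.im < yn w.re → 1 < m * I0 τ w := fun h => by
      rw [← h2]
      exact mul_lt_mul_of_pos_left (I0_strict τ hτ (v := ⟨w.re, yn w.re⟩) hw rfl h) hmp
    have C : yn w.re = w.im → m * I0 τ w = 1 := fun h => by rw [h] at h2; exact h2
    refine ⟨⟨A, fun h => ?_⟩, fun h => ?_⟩
    · by_contra h'
      rcases (not_lt.1 h').lt_or_eq with h'' | h''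
      · linarith [B h'']
      · linarith [C h''.symm]
    · by_contra h'
      linarith [B (not_le.1 h')]
  · refine ⟨⟨fun _ => ?_, fun _ => by rw [h1]; exact hw⟩, fun _ => by rw [h1]; exact hw.le⟩
    by_contra hcon
    have hge : 1 ≤ m * I0 τ ⟨w.re, w.im⟩ := not_lt.1 hcon
    have hl : Tendsto (fun y : ℝ => m * I0 τ ⟨w.re, y⟩) atTop (𝓝 0) := by
      simpa using (I0_lim τ w.re).const_mul m
    obtain ⟨y, hy1, hy2⟩ := ((hl.eventually (gt_mem_nhds zero_lt_one)).and
      (eventually_ge_atTop w.im)).exists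
    have hcont : ContinuousOn (fun y : ℝ => m * I0 τ ⟨w.re, y⟩) (Icc w.im y) := by
      intro t ht
      apply ContinuousAt.continuousWithinAt
      have h3 : ContinuousAt (I0 τ) (⟨w.re, t⟩ : ℂ) := I0_cont τ (hw.trans_le ht.1)
      have h4 : ContinuousAt (fun t : ℝ => (⟨w.re, t⟩ : ℂ)) t := by
        have : (fun t : ℝ => (⟨w.re, t⟩ : ℂ)) = fun t : ℝ => (w.re : ℂ) + t * Complex.I := by
          ext t; exact Complex.mk_eq_add_mul_I _ _
        rw [this]; fun_prop
      exact continuousAt_const.mul (ContinuousAt.comp (f := fun t : ℝ => (⟨w.re, t⟩ : ℂ)) h3 h4)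
    obtain ⟨t, ht, ht2⟩ := intermediate_value_Icc' hy2 hcont ⟨hy1.le, hge⟩
    exact h2 t (hw.trans_le ht.1) ht2

lemma core (hm : 0 ≤ m) (yn : ℝ → ℝ)
    (hyn : ∀ x : ℝ, (0 < yn x ∧ m * I0 τ ⟨x, yn x⟩ = 1)
      ∨ (yn x = 0 ∧ ∀ y : ℝ, 0 < y → m * I0 τ ⟨x, y⟩ ≠ 1))
    (Z : ℂ → ℂ) (hd : DifferentiableOn ℂ Z {z : ℂ | 0 < z.im})
    (hpos : ∀ z : ℂ, 0 < z.im → 0 < (Z z).im)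
    (hHZ : ∀ z : ℂ, 0 < z.im → H τ m a (Z z) = z) :
    Set.BijOn Z {z : ℂ | 0 < z.im} {z : ℂ | yn z.re < z.im} ∧
    ∃ Zb : ℂ → ℂ, ContinuousOn Zb {z : ℂ | 0 ≤ z.im} ∧
      (∀ z : ℂ, 0 < z.im → Zb z = Z z) ∧
      Topology.IsEmbedding (fun x : ℝ => Zb (x : ℂ)) ∧
      Set.range (fun x : ℝ => Zb (x : ℂ)) = {z : ℂ | z.im = yn z.re} := by
  have hyn0 : ∀ x, 0 ≤ yn x := fun x => by rcases hyn x with h | h <;> linarith [h.1]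
  have char := fun {w : ℂ} (hw : 0 < w.im) => yn_char τ m hm yn hyn hw
  have hI : ∀ z : ℂ, 0 < z.im → m * I0 τ (Z z) < 1 := fun z hz => by
    have h1 := H_im τ m a (hpos z hz)
    rw [hHZ z hz] at h1
    have := pos_of_mul_pos_right (h1 ▸ hz) (hpos z hz).le
    linarith
  have hD : ∀ z : ℂ, 0 < z.im → yn (Z z).re < (Z z).im := fun z hz => (char (hpos z hz)).1.2 (hI z hz)
  have hDpos : ∀ w : ℂ, yn w.re < w.im → 0 < w.im := fun w hw => (hyn0 _).trans_lt hw
  have hDI : ∀ w : ℂ, yn w.re < w.im → m * I0 τ w < 1 := fun w hw => (char (hDpos w hw)).1.1 hw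
  have hDH : ∀ w : ℂ, yn w.re < w.im → 0 < (H τ m a w).im := fun w hw => by
    rw [H_im τ m a (hDpos w hw)]
    exact mul_pos (hDpos w hw) (by linarith [hDI w hw])
  have hZH : ∀ w : ℂ, yn w.re < w.im → Z (H τ m a w) = w := fun w hw => by
    have h1 := hDH w hw
    have h2 := H_far τ m a hm (hpos _ h1) (hDpos w hw)
    rw [hHZ _ h1, sub_self, norm_zero] at h2
    have h3 := hI _ h1
    have h4 := hDI w hw
    have h5 : ‖Z (H τ m a w) - w‖ ≤ 0 := nonpos_of_mul_nonpos_left h2 (by linarith)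
    exact sub_eq_zero.1 (norm_le_zero_iff.1 h5)
  refine ⟨⟨fun z hz => hD z hz, fun z hz z' hz' h => ?_, fun w hw => ⟨H τ m a w, hDH w hw, hZH w hw⟩⟩, ?_⟩
  · rw [← hHZ z hz, ← hHZ z' hz', h]
  set A : Set ℂ := {z : ℂ | 0 < z.im} with hA
  have hlip : ∀ z ∈ A, ∀ z' ∈ A, ‖z - z'‖ ≤ 2 * ‖Z z - Z z'‖ := fun z hz z' hz' => by
    have := H_lip τ m a hm (hpos z hz) (hpos z' hz') (hI z hz).le (hI z' hz').le
    rwa [hHZ z hz, hHZ z' hz'] at this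
  have hcl : {z : ℂ | 0 ≤ z.im} ⊆ closure A := by
    rw [hA, Complex.closure_setOfPred_lt_im]
  -- local boundedness
  have hIA : Complex.I ∈ A := by simp [hA]
  obtain ⟨L, hL0, hL⟩ : ∃ L : ℝ, 0 < L ∧ ∀ z ∈ A, ‖Z z‖ ≤ L * (‖z‖ + 1) + ‖Z Complex.I‖ := by
    have h1 := hI _ hIA
    set q := m * I0 τ (Z Complex.I) with hq
    refine ⟨2 / (1 - q), by apply div_pos two_pos; linarith, fun z hz => ?_⟩
    have h2 := H_far τ m a hm (hpos z hz) (hpos _ hIA)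
    rw [hHZ z hz, hHZ _ hIA, ← hq] at h2
    have h3 := hI z hz
    have h4 : ‖Z z - Z Complex.I‖ * ((1 - q) / 2) ≤ ‖z - Complex.I‖ := by
      refine le_trans ?_ h2
      gcongr
      linarith
    have h5 : ‖z - Complex.I‖ ≤ ‖z‖ + 1 := (norm_sub_le _ _).trans (by simp)
    have h6 : ‖Z z‖ ≤ ‖Z z - Z Complex.I‖ + ‖Z Complex.I‖ := by
      simpa using norm_add_le (Z z - Z Complex.I) (Z Complex.I)
    have h7 : ‖Z z - Z Complex.I‖ ≤ 2 / (1 - q) * (‖z‖ + 1) := by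
      have : 0 < 1 - q := by linarith
      rw [div_mul_eq_mul_div, le_div_iff₀ this]
      linarith
    linarith
  have hlim : ∀ x ∈ {z : ℂ | 0 ≤ z.im}, ∃ y, Tendsto Z (𝓝[A] x) (𝓝 y) := by
    intro x hx
    have : (𝓝[A] x).NeBot := mem_closure_iff_nhdsWithin_neBot.1 (hcl hx)
    apply cauchy_map_iff_exists_tendsto.1
    set R := L * ((‖x‖ + 1) + 1) + ‖Z Complex.I‖ + 1 with hR
    obtain ⟨C, hC, hcub⟩ := H_cubic τ m a hm R (by
      have : 0 ≤ L * ((‖x‖ + 1) + 1) := by positivity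
      linarith [norm_nonneg (Z Complex.I)])
    rw [Metric.cauchy_iff]
    refine ⟨inferInstance, fun ε hε => ?_⟩
    set δ := min 1 (ε^3 / (4 * C)) with hδ
    have hδ0 : 0 < δ := by positivity
    refine ⟨Z '' (A ∩ Metric.ball x δ), ?_, ?_⟩
    · apply image_mem_map
      exact inter_mem self_mem_nhdsWithin (mem_nhdsWithin_of_mem_nhds (Metric.ball_mem_nhds x hδ0))
    · rintro _ ⟨z, ⟨hz, hzb⟩, rfl⟩ _ ⟨z', ⟨hz', hzb'⟩, rfl⟩
      have hn : ∀ z ∈ A, z ∈ Metric.ball x δ → ‖Z z‖ ≤ R := fun z hz hzb => by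
        rw [mem_ball_iff_norm] at hzb
        have h1 : ‖z‖ ≤ ‖x‖ + 1 := by
          have := norm_add_le (z - x) x
          rw [sub_add_cancel] at this
          have := min_le_left 1 (ε^3 / (4 * C))
          linarith
        have h2 := hL z hz
        have h3 : L * (‖z‖ + 1) ≤ L * ((‖x‖ + 1) + 1) := by gcongr
        linarith
      have h1 := hcub _ _ (hpos z hz) (hpos z' hz') (hI z hz).le (hI z' hz').le (hn z hz hzb) (hn z' hz' hzb')
      rw [hHZ z hz, hHZ z' hz'] at h1
      rw [Metric.mem_ball] at hzb hzb'
      have h2 : ‖z - z'‖ ≤ 2 * δ := by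
        rw [← dist_eq_norm]
        have := dist_triangle_right z z' x
        linarith
      have h3 : δ ≤ ε^3 / (4 * C) := min_le_right _ _
      have h4 : ‖Z z - Z z'‖^3 < ε^3 := by
        calc _ ≤ C * ‖z - z'‖ := h1
          _ ≤ C * (2 * (ε^3 / (4 * C))) := by gcongr; linarith
          _ = ε^3 / 2 := by field_simp; ring
          _ < ε^3 := by have : 0 < ε^3 := by positivity
                        linarith
      rw [dist_eq_norm]
      exact lt_of_pow_lt_pow_left₀ 3 hε.le h4
  have hext : ∀ z ∈ A, extendFrom A Z z = Z z := extendFrom_extends hd.continuousOn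
  have hcon := continuousOn_extendFrom hcl hlim
  have htend : ∀ z : ℂ, 0 ≤ z.im → Tendsto Z (𝓝[A] z) (𝓝 (extendFrom A Z z)) :=
    fun z hz => tendsto_extendFrom (hlim z hz)
  have hpath : ∀ z : ℂ, 0 ≤ z.im →
      Tendsto (fun ε : ℝ => z + ε * Complex.I) (𝓝[>] 0) (𝓝[A] z) := fun z hz => by
    apply tendsto_nhdsWithin_of_tendsto_nhds_of_eventually_within
    · have : Continuous (fun ε : ℝ => z + ε * Complex.I) := by fun_prop
      have h := this.tendsto 0
      simp only [ofReal_zero, zero_mul, add_zero] at h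
      exact h.mono_left nhdsWithin_le_nhds
    · filter_upwards [self_mem_nhdsWithin] with ε hε
      have : 0 < ε := hε
      simp [hA]; linarith
  have hpathT : ∀ z : ℂ, 0 ≤ z.im →
      Tendsto (fun ε : ℝ => Z (z + ε * Complex.I)) (𝓝[>] 0) (𝓝 (extendFrom A Z z)) :=
    fun z hz => (htend z hz).comp (hpath z hz)
  have hreal : ∀ x : ℝ, 0 ≤ (x:ℂ).im := fun x => by simp
  have hanti : ∀ x y : ℝ, |x - y| ≤ 2 * ‖extendFrom A Z (x:ℂ) - extendFrom A Z (y:ℂ)‖ := fun x y => by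
    have h1 := (((hpathT x (hreal x)).sub (hpathT y (hreal y))).norm).const_mul 2
    refine ge_of_tendsto h1 ?_
    filter_upwards [self_mem_nhdsWithin] with ε hε
    have hε' : 0 < ε := hε
    have := hlip (x + ε * Complex.I) (by simpa [hA] using hε') (y + ε * Complex.I) (by simpa [hA] using hε')
    refine le_trans (le_of_eq ?_) this
    rw [add_sub_add_right_eq_sub, ← ofReal_sub, Complex.norm_real, Real.norm_eq_abs]
  have hcont : Continuous (fun x : ℝ => extendFrom A Z (x:ℂ)) := by
    rw [← continuousOn_univ]
    exact hcon.comp Complex.continuous_ofReal.continuousOn (fun x _ => hreal x)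
  refine ⟨extendFrom A Z, hcon, hext, ⟨Topology.isInducing_iff_nhds.2 fun x => ?_, fun x y hxy => ?_⟩, ?_⟩
  · apply le_antisymm (hcont.tendsto x).le_comap
    intro s hs
    obtain ⟨ε, hε, hs⟩ := Metric.mem_nhds_iff.1 hs
    refine ⟨Metric.ball (extendFrom A Z (x:ℂ)) (ε / 2), Metric.ball_mem_nhds _ (by positivity), fun y hy => hs ?_⟩
    rw [mem_preimage, mem_ball_iff_norm] at hy
    rw [Metric.mem_ball, Real.dist_eq]
    linarith [hanti y x]
  · have := hanti x y
    have hxy' : extendFrom A Z (x:ℂ) = extendFrom A Z (y:ℂ) := hxy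
    rw [hxy', sub_self, norm_zero, mul_zero] at this
    exact sub_eq_zero.1 (abs_nonpos_iff.1 this)
  -- range
  ext w
  constructor
  · rintro ⟨x, rfl⟩
    show (extendFrom A Z (x:ℂ)).im = yn (extendFrom A Z (x:ℂ)).re
    have hT := hpathT x (hreal x)
    set w := extendFrom A Z (x:ℂ) with hw
    have hwim : 0 ≤ w.im := by
      refine ge_of_tendsto ((Complex.continuous_im.tendsto w).comp hT) ?_
      filter_upwards [self_mem_nhdsWithin] with ε hε
      exact (hpos _ (by simpa using hε)).le
    have hge : yn w.re ≤ w.im := by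
      refine le_of_forall_pos_le_add fun t ht => ?_
      have hv : 0 < (w + t * Complex.I).im := by simp; linarith
      have h1 : m * I0 τ (w + t * Complex.I) ≤ 1 := by
        have h2 : Tendsto (fun ε : ℝ => m * I0 τ (Z (x + ε * Complex.I) + t * Complex.I)) (𝓝[>] 0)
            (𝓝 (m * I0 τ (w + t * Complex.I))) :=
          ((I0_cont τ hv).tendsto.comp (hT.add_const (t * Complex.I))).const_mul m
        refine le_of_tendsto h2 ?_
        filter_upwards [self_mem_nhdsWithin] with ε hε
        have h3 := hD (x + ε * Complex.I) (by simpa using hε)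
        refine (hDI _ ?_).le
        simp only [add_re, add_im, mul_re, mul_im, ofReal_re, ofReal_im, I_re, I_im] at h3 ⊢
        simp only [mul_zero, mul_one, zero_mul, sub_zero, add_zero]
        linarith
      have := (char hv).2 h1
      simpa using this
    by_contra hne
    have hlt : yn w.re < w.im := lt_of_le_of_ne hge (Ne.symm hne)
    have h1 := hDH w hlt
    have h2 : Tendsto (fun ε : ℝ => H τ m a (Z (x + ε * Complex.I))) (𝓝[>] 0) (𝓝 (H τ m a w)) :=
      (H_cont τ m a (hDpos w hlt)).tendsto.comp hT
    have h3 : Tendsto (fun ε : ℝ => H τ m a (Z (x + ε * Complex.I))) (𝓝[>] 0) (𝓝 (x:ℂ)) := by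
      refine ((hpath x (hreal x)).mono_right nhdsWithin_le_nhds).congr' ?_
      filter_upwards [self_mem_nhdsWithin] with ε hε
      exact (hHZ _ (by simpa using hε)).symm
    rw [tendsto_nhds_unique h2 h3] at h1
    simp at h1
  · intro hw
    have hw' : w.im = yn w.re := hw
    have hDw : ∀ ε : ℝ, 0 < ε → yn (w + ε * Complex.I).re < (w + ε * Complex.I).im := fun ε hε => by
      simp; linarith
    have hTw : Tendsto (fun ε : ℝ => w + ε * Complex.I) (𝓝[>] 0) (𝓝 w) := by
      have : Continuous (fun ε : ℝ => w + ε * Complex.I) := by fun_prop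
      have h := this.tendsto 0
      simp only [ofReal_zero, zero_mul, add_zero] at h
      exact h.mono_left nhdsWithin_le_nhds
    obtain ⟨z, hz⟩ : ∃ z, Tendsto (fun ε : ℝ => H τ m a (w + ε * Complex.I)) (𝓝[>] 0) (𝓝 z) := by
      apply cauchy_map_iff_exists_tendsto.1
      rw [Metric.cauchy_iff]
      refine ⟨inferInstance, fun ε hε => ?_⟩
      refine ⟨(fun ε : ℝ => H τ m a (w + ε * Complex.I)) '' (Ioo 0 (ε/2)), ?_, ?_⟩
      · exact image_mem_map (Ioo_mem_nhdsGT (by positivity))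
      · rintro _ ⟨s, hs, rfl⟩ _ ⟨t, ht, rfl⟩
        have h1 := hDw s hs.1
        have h2 := hDw t ht.1
        have := H_lip τ m a hm (hDpos _ h1) (hDpos _ h2) (hDI _ h1).le (hDI _ h2).le
        rw [dist_eq_norm]
        refine this.trans_lt ?_
        rw [add_sub_add_left_eq_sub, ← sub_mul, ← ofReal_sub, norm_mul, Complex.norm_real, Complex.norm_I,
          mul_one, Real.norm_eq_abs]
        have : |s - t| < ε / 2 := by rw [abs_lt]; constructor <;> linarith [hs.1, hs.2, ht.1, ht.2]
        linarith
    have hev : ∀ᶠ ε : ℝ in 𝓝[>] 0, H τ m a (w + ε * Complex.I) ∈ A := by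
      filter_upwards [self_mem_nhdsWithin] with ε hε
      exact hDH _ (hDw ε hε)
    have hzim : 0 ≤ z.im := by
      refine ge_of_tendsto ((Complex.continuous_im.tendsto z).comp hz) ?_
      filter_upwards [hev] with ε hε
      exact le_of_lt hε
    have hzA : Tendsto (fun ε : ℝ => H τ m a (w + ε * Complex.I)) (𝓝[>] 0) (𝓝[A] z) :=
      tendsto_nhdsWithin_of_tendsto_nhds_of_eventually_within _ hz hev
    have h1 := (htend z hzim).comp hzA
    have h2 : Tendsto (Z ∘ (fun ε : ℝ => H τ m a (w + ε * Complex.I))) (𝓝[>] 0) (𝓝 w) := by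
      refine hTw.congr' ?_
      filter_upwards [self_mem_nhdsWithin] with ε hε
      exact (hZH _ (hDw ε hε)).symm
    have h3 : extendFrom A Z z = w := tendsto_nhds_unique h1 h2
    have hz0 : z.im = 0 := by
      by_contra hne
      have hzp : 0 < z.im := lt_of_le_of_ne hzim (Ne.symm hne)
      have h4 := hD z hzp
      rw [← hext z hzp, h3] at h4
      linarith
    refine ⟨z.re, ?_⟩
    have : ((z.re : ℝ) : ℂ) = z := by apply Complex.ext <;> simp [hz0]
    show extendFrom A Z ((z.re : ℝ) : ℂ) = w
    rw [this, h3]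
end

theorem stmt_9
    (μ : Measure ℝ) [IsProbabilityMeasure μ] (n : ℕ) (hn : 1 ≤ n)
    (Z : ℂ → ℂ) (hZ : Subord μ n Z)
    (τ : Measure ℝ) [IsFiniteMeasure τ]
    (hrep : ∀ z : ℂ, 0 < z.im →
      recip μ z = z + ((recip μ Complex.I).re : ℂ)
        + ∫ u, (1 + (u : ℂ) * z) / ((u : ℂ) - z) ∂τ)
    (yn : ℝ → ℝ)
    (hyn : ∀ x : ℝ,
      (0 < yn x ∧
        ((n : ℝ) - 1) * (∫ u, (1 + u ^ 2) / ((u - x) ^ 2 + yn x ^ 2) ∂τ) = 1)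
      ∨ (yn x = 0 ∧ ∀ y : ℝ, 0 < y →
        ((n : ℝ) - 1) * (∫ u, (1 + u ^ 2) / ((u - x) ^ 2 + y ^ 2) ∂τ) ≠ 1)) :
    DifferentiableOn ℂ Z {z : ℂ | 0 < z.im} ∧
    Set.BijOn Z {z : ℂ | 0 < z.im} {z : ℂ | yn z.re < z.im} ∧
    ∃ Zb : ℂ → ℂ, ContinuousOn Zb {z : ℂ | 0 ≤ z.im} ∧
      (∀ z : ℂ, 0 < z.im → Zb z = Z z) ∧
      Topology.IsEmbedding (fun x : ℝ => Zb (x : ℂ)) ∧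
      Set.range (fun x : ℝ => Zb (x : ℂ)) = {z : ℂ | z.im = yn z.re} := by
  have hm : (0:ℝ) ≤ (n:ℝ) - 1 := by
    have : (1:ℝ) ≤ n := by exact_mod_cast hn
    linarith
  obtain ⟨⟨ν, hν, hZν⟩, hsub⟩ := hZ
  have hd : DifferentiableOn ℂ Z {z : ℂ | 0 < z.im} := by
    intro z hz
    have h1 : DifferentiableAt ℂ (fun z => (cauchy ν z)⁻¹) z :=
      (cauchy_diff ν hz).inv (cauchy_ne_s9 ν hz)
    exact h1.differentiableWithinAt.congr (fun y hy => hZν y hy) (hZν z hz)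
  have hpos : ∀ z : ℂ, 0 < z.im → 0 < (Z z).im := fun z hz => by
    rw [hZν z hz]; exact recip_im ν hz
  refine ⟨hd, core τ ((n:ℝ) - 1) (recip μ Complex.I).re hm yn hyn Z hd hpos fun z hz => ?_⟩
  have h1 := hsub z hz
  rw [hrep _ (hpos z hz)] at h1
  change z = _ * _ - _ * (_ + _ + K τ (Z z)) at h1
  rw [H]
  push_cast
  linear_combination -h1

end FreeCLT
end
end
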